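/- arXiv:1507.06095 — 3 statements merged into one kernel-verified Lean document; each statement's English description precedes it below -/
import Mathlib

section
/- Under the standing assumptions on a, b, F, suppose that the linear equation v'' + (B/a(t))·v = 0 is disconjugate on [1,∞), and that there exist t₁, t₂ ∈ (0,1) with t₁ < t₂ such that ∫_{t₁}^{t₂} b(t) dt > 0, min{k₀, k_∞}·A(1)·|b|_L < 1, and max{k₀, k_∞}·∫_{t₁}^{t₂} b(t) dt > A(1)/(A(t₁)(A(1) − A(t₂))). Then there exists a solution x of (a(t)x')' + b(t)F(x) = 0 on [0,∞) satisfying x(0) = 0, x(t) > 0 for all t ∈ (0,∞), and lim_{t→∞} x(t) = 0. Moreover, x attains a local maximum at some point of (0,1], x is decreasing on [1,∞), and ∫₁^∞ dt/(a(t)·x(t)²) = ∞. -/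
open Set Filter MeasureTheory Topology Real

/-- `x` (with derivative `x'`) is a solution of `(a(t) x')' + c(t) F(x) = 0` on `I`:
`x` is `C¹` on `I`, `t ↦ a t * x' t` is `C¹` on `I`, and the equation holds on `I`. -/
def SolODE (a c F : ℝ → ℝ) (I : Set ℝ) (x x' : ℝ → ℝ) : Prop :=
  (∀ t ∈ I, HasDerivWithinAt x (x' t) I t) ∧ ContinuousOn x' I ∧
  ∃ w : ℝ → ℝ, (∀ t ∈ I, HasDerivWithinAt (fun s => a s * x' s) (w t) I t) ∧
    ContinuousOn w I ∧ ∀ t ∈ I, w t + c t * F (x t) = 0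

/-- `z` (with derivatives `z'`, `z''`) is a `C²` solution of `z'' + c(t) F(z) = 0` on `I`. -/
def SolODE2 (c F : ℝ → ℝ) (I : Set ℝ) (z z' z'' : ℝ → ℝ) : Prop :=
  (∀ t ∈ I, HasDerivWithinAt z (z' t) I t) ∧ (∀ t ∈ I, HasDerivWithinAt z' (z'' t) I t) ∧
  ContinuousOn z'' I ∧ ∀ t ∈ I, z'' t + c t * F (z t) = 0

/-- The linear equation `(a(t) y')' + β(t) y = 0` is disconjugate on `I`:
every nontrivial solution has at most one zero in `I`. -/
def Disconjugate (a β : ℝ → ℝ) (I : Set ℝ) : Prop :=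
  ∀ y y' : ℝ → ℝ, SolODE a β id I y y' → (∃ t ∈ I, y t ≠ 0) →
    ∀ t₁ ∈ I, ∀ t₂ ∈ I, y t₁ = 0 → y t₂ = 0 → t₁ = t₂

/-- The linear equation `v'' + β(t) v = 0` is disconjugate on `I`:
every nontrivial solution has at most one zero in `I`. -/
def Disconjugate2 (β : ℝ → ℝ) (I : Set ℝ) : Prop :=
  ∀ v v' v'' : ℝ → ℝ, SolODE2 β id I v v' v'' → (∃ t ∈ I, v t ≠ 0) →
    ∀ t₁ ∈ I, ∀ t₂ ∈ I, v t₁ = 0 → v t₂ = 0 → t₁ = t₂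

/-- Mean value inequality for a function with nonnegative derivative. -/
lemma le_of_hasDerivAt_nonneg {f f' : ℝ → ℝ} {p q : ℝ} (hpq : p ≤ q)
    (hd : ∀ t ∈ Icc p q, HasDerivAt f (f' t) t) (h : ∀ t ∈ Icc p q, 0 ≤ f' t) : f p ≤ f q := by
  have hm : MonotoneOn f (Icc p q) := by
    apply monotoneOn_of_deriv_nonneg (convex_Icc p q)
    · exact fun t ht => (hd t ht).continuousAt.continuousWithinAt
    · exact fun t ht => (hd t (interior_subset ht)).differentiableAt.differentiableWithinAt
    · intro t ht
      rw [(hd t (interior_subset ht)).deriv]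
      exact h t (interior_subset ht)
  exact hm (left_mem_Icc.2 hpq) (right_mem_Icc.2 hpq) hpq

lemma lt_of_hasDerivAt_pos {f f' : ℝ → ℝ} {p q : ℝ} (hpq : p < q)
    (hd : ∀ t ∈ Icc p q, HasDerivAt f (f' t) t) (h : ∀ t ∈ Ioo p q, 0 < f' t) : f p < f q := by
  have hm : StrictMonoOn f (Icc p q) := by
    apply strictMonoOn_of_deriv_pos (convex_Icc p q)
    · exact fun t ht => (hd t ht).continuousAt.continuousWithinAt
    · intro t ht
      rw [(hd t (interior_subset ht)).deriv]
      rw [interior_Icc] at ht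
      exact h t ht
  exact hm (left_mem_Icc.2 hpq.le) (right_mem_Icc.2 hpq.le) hpq

lemma exists_first_zero {f : ℝ → ℝ} {p q : ℝ} (hpq : p ≤ q) (hf : ContinuousOn f (Icc p q))
    (hp : 0 < f p) (hq : f q ≤ 0) : ∃ T ∈ Ioc p q, f T = 0 ∧ ∀ t ∈ Ico p T, 0 < f t := by
  have hcl : IsClosed (Icc p q ∩ f ⁻¹' Iic 0) :=
    hf.preimage_isClosed_of_isClosed isClosed_Icc isClosed_Iic
  have hcomp : IsCompact (Icc p q ∩ f ⁻¹' Iic 0) :=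
    isCompact_Icc.of_isClosed_subset hcl inter_subset_left
  obtain ⟨T, ⟨hT, hfT⟩, hleast⟩ := hcomp.exists_isLeast ⟨q, right_mem_Icc.2 hpq, hq⟩
  have hpT : p < T := by
    rcases hT.1.eq_or_lt with h | h
    · subst h; exact absurd hfT (not_le.2 hp)
    · exact h
  obtain ⟨c, hc, hc0⟩ := intermediate_value_Icc' hT.1 (hf.mono (Icc_subset_Icc_right hT.2))
    (show (0:ℝ) ∈ Icc (f T) (f p) from ⟨hfT, hp.le⟩)
  have hTc : T ≤ c := hleast ⟨⟨hc.1, hc.2.trans hT.2⟩, hc0.le⟩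
  have : c = T := le_antisymm hc.2 hTc
  subst this
  refine ⟨c, ⟨hpT, hT.2⟩, hc0, fun t ht => ?_⟩
  by_contra hcon
  exact absurd (hleast ⟨⟨ht.1, ht.2.le.trans hT.2⟩, not_lt.1 hcon⟩) (not_le.2 ht.2)

/-- `(x, u)` solves the first order system `x' = u / a`, `u' = - b G(x)` for `t ≥ t₀`. -/
def IsFlow (a b G : ℝ → ℝ) (t₀ : ℝ) (x u : ℝ → ℝ) : Prop :=
  ∀ t, t₀ ≤ t → HasDerivAt x (u t / a t) t ∧ HasDerivAt u (-(b t * G (x t))) t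

/-- Global existence and Lipschitz dependence on the initial slope, by contraction in a weighted
supremum norm. -/
lemma exists_flow {a b G : ℝ → ℝ} (ha : Continuous a) (ha_pos : ∀ t, 0 < a t) (hb : Continuous b)
    (hG : LipschitzWith 1 G) (hG0 : G 0 = 0) (t₀ : ℝ) :
    ∃ (x u : ℝ → ℝ → ℝ) (C : ℝ → ℝ), Monotone C ∧ (∀ s, x s t₀ = 0) ∧ (∀ s, u s t₀ = s) ∧
      (∀ s, IsFlow a b G t₀ (x s) (u s)) ∧
      ∀ s s' t, t₀ ≤ t → |x s t - x s' t| ≤ C t * |s - s'| ∧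
        |u s t - u s' t| ≤ C t * |s - s'| := by
  have hia : Continuous fun t => 1 / a t := continuous_const.div ha fun t => (ha_pos t).ne'
  set k : ℝ → ℝ := fun t => 2 * (1 / a t + |b t|) with hk
  have hkc : Continuous k := continuous_const.mul (hia.add hb.abs)
  have hiapos : ∀ t, 0 < 1 / a t := fun t => one_div_pos.2 (ha_pos t)
  have hk0 : ∀ t, 0 ≤ k t := fun t => by
    have := hiapos t
    have := abs_nonneg (b t)
    simp only [hk]; linarith
  set φ : ℝ → ℝ := fun t => exp (∫ r in t₀..t, k r) with hφ
  have hφd : ∀ t, HasDerivAt φ (φ t * k t) t := fun t =>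
    (hkc.integral_hasStrictDerivAt t₀ t).hasDerivAt.exp
  have hφc : Continuous φ := continuous_iff_continuousAt.2 fun t => (hφd t).continuousAt
  have hφpos : ∀ t, 0 < φ t := fun t => exp_pos _
  have hφmono : Monotone φ := monotone_of_hasDerivAt_nonneg hφd
    fun t => mul_nonneg (hφpos t).le (hk0 t)
  have hφ0 : φ t₀ = 1 := by simp [hφ]
  have hφint : ∀ t, ∫ r in t₀..t, φ r * k r = φ t - 1 := fun t => by
    rw [intervalIntegral.integral_eq_sub_of_hasDerivAt (fun r _ => hφd r)
      ((hφc.mul hkc).intervalIntegrable _ _), hφ0]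
  have hbφ : ∀ t, t₀ ≤ t → ∫ r in t₀..t, |b r| * φ r ≤ φ t / 2 := fun t ht => by
    have : ∫ r in t₀..t, |b r| * φ r ≤ ∫ r in t₀..t, (1 / 2) * (φ r * k r) := by
      apply intervalIntegral.integral_mono_on ht ((hb.abs.mul hφc).intervalIntegrable _ _)
        ((continuous_const.mul (hφc.mul hkc)).intervalIntegrable _ _)
      intro r _
      have := mul_pos (hφpos r) (hiapos r)
      change |b r| * φ r ≤ 1 / 2 * (φ r * (2 * (1 / a r + |b r|)))
      linarith
    rw [intervalIntegral.integral_const_mul, hφint] at this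
    linarith
  have haφ : ∀ t, t₀ ≤ t → ∫ r in t₀..t, φ r / a r ≤ φ t / 2 := fun t ht => by
    have : ∫ r in t₀..t, φ r / a r ≤ ∫ r in t₀..t, (1 / 2) * (φ r * k r) := by
      apply intervalIntegral.integral_mono_on ht
        ((hφc.div ha fun t => (ha_pos t).ne').intervalIntegrable _ _)
        ((continuous_const.mul (hφc.mul hkc)).intervalIntegrable _ _)
      intro r _
      have := mul_nonneg (hφpos r).le (abs_nonneg (b r))
      change φ r / a r ≤ 1 / 2 * (φ r * (2 * (1 / a r + |b r|)))
      rw [div_eq_mul_one_div (φ r) (a r)]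
      linarith
    rw [intervalIntegral.integral_const_mul, hφint] at this
    linarith
  have hA : ∀ t, t₀ ≤ t → ∫ r in t₀..t, 1 / a r ≤ φ t / 2 := fun t ht => by
    refine le_trans ?_ (haφ t ht)
    apply intervalIntegral.integral_mono_on ht (hia.intervalIntegrable _ _)
        ((hφc.div ha fun t => (ha_pos t).ne').intervalIntegrable _ _)
    intro r hr
    have : 1 ≤ φ r := hφ0 ▸ hφmono hr.1
    exact div_le_div_of_nonneg_right this (ha_pos r).le
  let U : ℝ → BoundedContinuousFunction ℝ ℝ → ℝ → ℝ := fun s y t =>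
    s - ∫ r in t₀..t, b r * G (φ r * y r)
  let X : ℝ → BoundedContinuousFunction ℝ ℝ → ℝ → ℝ := fun s y t => ∫ r in t₀..t, U s y r / a r
  have hintc : ∀ y : BoundedContinuousFunction ℝ ℝ,
      Continuous fun r => b r * G (φ r * y r) := fun y =>
    hb.mul (hG.continuous.comp (hφc.mul y.continuous))
  have hUd : ∀ s y t, HasDerivAt (U s y) (-(b t * G (φ t * y t))) t := fun s y t => by
    simpa [U] using ((hintc y).integral_hasStrictDerivAt t₀ t).hasDerivAt.const_sub s
  have hUc : ∀ s y, Continuous (U s y) := fun s y =>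
    continuous_iff_continuousAt.2 fun t => (hUd s y t).continuousAt
  have hUac : ∀ s y, Continuous fun r => U s y r / a r := fun s y =>
    (hUc s y).div ha fun t => (ha_pos t).ne'
  have hXd : ∀ s y t, HasDerivAt (X s y) (U s y t / a t) t := fun s y t =>
    ((hUac s y).integral_hasStrictDerivAt t₀ t).hasDerivAt
  have hXc : ∀ s y, Continuous (X s y) := fun s y =>
    continuous_iff_continuousAt.2 fun t => (hXd s y t).continuousAt
  have hUest : ∀ s s' y y' t, t₀ ≤ t →
      |U s y t - U s' y' t| ≤ |s - s'| + φ t / 2 * ‖y - y'‖ := by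
    intro s s' y y' t ht
    have e : U s y t - U s' y' t
        = (s - s') - ∫ r in t₀..t, (b r * G (φ r * y r) - b r * G (φ r * y' r)) := by
      rw [intervalIntegral.integral_sub ((hintc y).intervalIntegrable _ _)
        ((hintc y').intervalIntegrable _ _)]
      simp only [U]; ring
    rw [e]
    refine (abs_sub _ _).trans (add_le_add le_rfl ?_)
    have h1 : |∫ r in t₀..t, (b r * G (φ r * y r) - b r * G (φ r * y' r))|
        ≤ ∫ r in t₀..t, (|b r| * φ r) * ‖y - y'‖ := by
      rw [← Real.norm_eq_abs]
      apply intervalIntegral.norm_integral_le_of_norm_le ht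
      · refine Filter.Eventually.of_forall fun r _ => ?_
        rw [← mul_sub, norm_mul, Real.norm_eq_abs, mul_assoc]
        refine mul_le_mul_of_nonneg_left ?_ (abs_nonneg _)
        have h2 := hG.dist_le_mul (φ r * y r) (φ r * y' r)
        rw [NNReal.coe_one, one_mul, Real.dist_eq, Real.dist_eq, ← mul_sub, abs_mul,
          abs_of_pos (hφpos r)] at h2
        refine h2.trans (mul_le_mul_of_nonneg_left ?_ (hφpos r).le)
        exact (y - y').norm_coe_le_norm r
      · exact ((hb.abs.mul hφc).mul continuous_const).intervalIntegrable _ _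
    rw [intervalIntegral.integral_mul_const] at h1
    exact h1.trans (mul_le_mul_of_nonneg_right (hbφ t ht) (norm_nonneg _))
  have hXest : ∀ s s' y y' t, t₀ ≤ t →
      |X s y t - X s' y' t| ≤ φ t * (|s - s'| / 2 + ‖y - y'‖ / 4) := by
    intro s s' y y' t ht
    have e : X s y t - X s' y' t = ∫ r in t₀..t, (U s y r / a r - U s' y' r / a r) := by
      rw [intervalIntegral.integral_sub ((hUac s y).intervalIntegrable _ _)
        ((hUac s' y').intervalIntegrable _ _)]
    have hc1 : Continuous fun r => 1 / a r * |s - s'| := hia.mul continuous_const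
    have hc2 : Continuous fun r => φ r / a r * (‖y - y'‖ / 2) :=
      (hφc.div ha fun t => (ha_pos t).ne').mul continuous_const
    have h1 : |X s y t - X s' y' t|
        ≤ ∫ r in t₀..t, (1 / a r * |s - s'| + φ r / a r * (‖y - y'‖ / 2)) := by
      rw [e, ← Real.norm_eq_abs]
      apply intervalIntegral.norm_integral_le_of_norm_le ht
      · refine Filter.Eventually.of_forall fun r hr => ?_
        rw [← sub_div, norm_div, Real.norm_eq_abs, Real.norm_eq_abs, abs_of_pos (ha_pos r)]
        have := div_le_div_of_nonneg_right (hUest s s' y y' r hr.1.le) (ha_pos r).le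
        refine this.trans (le_of_eq ?_)
        ring
      · exact (hc1.add hc2).intervalIntegrable _ _
    rw [intervalIntegral.integral_add (hc1.intervalIntegrable _ _) (hc2.intervalIntegrable _ _),
      intervalIntegral.integral_mul_const, intervalIntegral.integral_mul_const] at h1
    have h2 := mul_le_mul_of_nonneg_right (hA t ht) (abs_nonneg (s - s'))
    have h3 := mul_le_mul_of_nonneg_right (haφ t ht) (by positivity : 0 ≤ ‖y - y'‖ / 2)
    linarith
  have hU0 : ∀ t, U 0 0 t = 0 := fun t => by simp [U, hG0]
  have hX0 : ∀ t, X 0 0 t = 0 := fun t => by simp [X, hU0]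
  let Φ : ℝ → BoundedContinuousFunction ℝ ℝ → BoundedContinuousFunction ℝ ℝ := fun s y =>
    BoundedContinuousFunction.ofNormedAddCommGroup (fun t => X s y (max t t₀) / φ (max t t₀))
      (((hXc s y).comp (continuous_id.max continuous_const)).div
        (hφc.comp (continuous_id.max continuous_const)) fun t => (hφpos _).ne')
      (|s| / 2 + ‖y‖ / 4) (fun t => by
        have := hXest s 0 y 0 (max t t₀) (le_max_right _ _)
        rw [hX0, sub_zero, sub_zero, sub_zero] at this
        rw [norm_div, Real.norm_eq_abs, Real.norm_eq_abs, abs_of_pos (hφpos _),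
          div_le_iff₀ (hφpos _)]
        linarith)
  have hΦ : ∀ s s' y y', ‖Φ s y - Φ s' y'‖ ≤ |s - s'| / 2 + ‖y - y'‖ / 4 := by
    intro s s' y y'
    rw [BoundedContinuousFunction.norm_le (by positivity)]
    intro t
    have := hXest s s' y y' (max t t₀) (le_max_right _ _)
    have e : (Φ s y - Φ s' y') t
        = (X s y (max t t₀) - X s' y' (max t t₀)) / φ (max t t₀) := by
      simp [Φ, sub_div]
    rw [e, norm_div, Real.norm_eq_abs, Real.norm_eq_abs, abs_of_pos (hφpos _),
      div_le_iff₀ (hφpos _)]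
    linarith
  have hcontr : ∀ s, ContractingWith (1 / 4) (Φ s) := fun s => by
    refine ⟨?_, LipschitzWith.of_dist_le_mul fun y y' => ?_⟩
    · rw [← NNReal.coe_lt_coe]; norm_num
    · have := hΦ s s y y'
      rw [dist_eq_norm, dist_eq_norm]
      simp only [sub_self, abs_zero] at this
      push_cast
      linarith
  let y : ℝ → BoundedContinuousFunction ℝ ℝ := fun s => (hcontr s).fixedPoint
  have hy : ∀ s, Φ s (y s) = y s := fun s => (hcontr s).fixedPoint_isFixedPt
  have hyest : ∀ s s', ‖y s - y s'‖ ≤ |s - s'| := fun s s' => by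
    have := hΦ s s' (y s) (y s')
    rw [hy, hy] at this
    have h0 := abs_nonneg (s - s')
    linarith
  have hxy : ∀ s t, t₀ ≤ t → X s (y s) t = φ t * y s t := fun s t ht => by
    have h1 : Φ s (y s) t = X s (y s) (max t t₀) / φ (max t t₀) := rfl
    rw [hy, max_eq_left ht, eq_div_iff (hφpos t).ne'] at h1
    rw [← h1, mul_comm]
  refine ⟨fun s => X s (y s), fun s => U s (y s), fun t => 1 + φ t, hφmono.const_add 1,
    fun s => by simp [X], fun s => by simp [U], fun s t ht => ⟨hXd s (y s) t, ?_⟩, ?_⟩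
  · change HasDerivAt (U s (y s)) (-(b t * G (X s (y s) t))) t
    rw [hxy s t ht]
    exact hUd s (y s) t
  · intro s s' t ht
    have h0 := abs_nonneg (s - s')
    have h3 := hφpos t
    have h4 := mul_le_mul_of_nonneg_left (hyest s s') h3.le
    have h5 := mul_nonneg h3.le h0
    constructor
    · refine (hXest s s' (y s) (y s') t ht).trans ?_
      linarith
    · refine (hUest s s' (y s) (y s') t ht).trans ?_
      linarith

/-- Disconjugacy of the dual equation gives a positive solution `y` of `(a y')' + B y = 0` on
`[1, ∞)` with `y'(1) = 0`; here `η = a y'`. -/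
lemma exists_positive_majorant {a : ℝ → ℝ} {B : ℝ} (ha : Continuous a) (ha_pos : ∀ t, 0 < a t)
    (hB : 0 < B) (hdisc : Disconjugate2 (fun t => B / a t) (Ici 1)) :
    ∃ y η : ℝ → ℝ, y 1 = 1 ∧ η 1 = 0 ∧ (∀ t, 1 ≤ t → 0 < y t) ∧ (∀ t, 1 < t → η t < 0) ∧
      ∀ t, 1 ≤ t → HasDerivAt y (η t / a t) t ∧ HasDerivAt η (-(B * y t)) t := by
  have hBc : Continuous fun t => B / a t := continuous_const.div ha fun t => (ha_pos t).ne'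
  obtain ⟨X, Y, -, -, hX0, hY0, hflow, -⟩ := exists_flow (a := fun _ => 1)
    (b := fun t => B / a t) (G := id) continuous_const (fun _ => one_pos) hBc
    LipschitzWith.id rfl 1
  set v := X 1 with hv
  set w := Y 1 with hw
  have hv1 : v 1 = 0 := hX0 1
  have hw1 : w 1 = 1 := hY0 1
  have hvd : ∀ t, 1 ≤ t → HasDerivAt v (w t) t := fun t ht => by
    simpa using (hflow 1 t ht).1
  have hwd : ∀ t, 1 ≤ t → HasDerivAt w (-(B / a t * v t)) t := fun t ht => by
    simpa using (hflow 1 t ht).2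
  have hvc : ContinuousOn v (Ici 1) := fun t ht => (hvd t ht).continuousAt.continuousWithinAt
  have hpos_near : ∃ δ > 0, ∀ t, 1 ≤ t → t < 1 + δ → 0 < w t := by
    have := (hwd 1 le_rfl).continuousAt.eventually (lt_mem_nhds (show (0:ℝ) < w 1 by simp [hw1]))
    obtain ⟨δ, hδ, h⟩ := Metric.eventually_nhds_iff.1 this
    refine ⟨δ, hδ, fun t h1 h2 => h ?_⟩
    rw [Real.dist_eq, abs_of_nonneg (by linarith)]; linarith
  obtain ⟨δ, hδ, hwδ⟩ := hpos_near
  have hvδ : ∀ t, 1 < t → t < 1 + δ → 0 < v t := fun t h1 h2 => by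
    have := lt_of_hasDerivAt_pos h1 (fun r hr => hvd r hr.1)
      (fun r hr => hwδ r hr.1.le (hr.2.trans h2))
    rwa [hv1] at this
  have hmid : 0 < v (1 + δ / 2) := hvδ _ (by linarith) (by linarith)
  have hne : ∀ t, 1 < t → v t ≠ 0 := fun t ht h0 => by
    have := hdisc v w (fun t => -(B / a t * v t))
      ⟨fun t ht => (hvd t ht).hasDerivWithinAt, fun t ht => (hwd t ht).hasDerivWithinAt,
        (hBc.continuousOn.mul hvc).neg, fun t _ => by simp⟩
      ⟨1 + δ / 2, by simp only [mem_Ici]; linarith, hmid.ne'⟩ 1 self_mem_Ici t ht.le hv1 h0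
    exact ht.ne this
  have hvpos : ∀ t, 1 < t → 0 < v t := fun t ht => by
    by_contra hcon
    have hlt : v t < 0 := lt_of_le_of_ne (not_lt.1 hcon) (hne t ht)
    have hpc : IsPreconnected (Ioi (1:ℝ)) := isPreconnected_Ioi
    obtain ⟨c, hc, hc0⟩ := hpc.intermediate_value (show t ∈ Ioi (1:ℝ) from ht)
      (show 1 + δ / 2 ∈ Ioi (1:ℝ) by simp only [mem_Ioi]; linarith)
      (hvc.mono Ioi_subset_Ici_self) (show (0:ℝ) ∈ Icc _ _ from ⟨hlt.le, hmid.le⟩)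
    exact hne c hc hc0
  have hwanti : ∀ p q, 1 ≤ p → p < q → w q < w p := fun p q hp hpq => by
    have := lt_of_hasDerivAt_pos hpq (fun r hr => (hwd r (hp.trans hr.1)).neg)
      (fun r hr => by
        rw [neg_neg]
        exact mul_pos (div_pos hB (ha_pos r)) (hvpos r (hp.trans_lt hr.1)))
    simpa using this
  have hwpos : ∀ t, 1 ≤ t → 0 < w t := fun t ht => by
    by_contra hcon
    have hq : w (t + 1) < 0 := (hwanti t (t + 1) ht (by linarith)).trans_le (not_lt.1 hcon)
    set q := t + 1 with hqdef
    have hq1 : 1 < q := by linarith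
    have hvq := hvpos q hq1
    set T := q + v q / (-w q) with hT
    have hqT : q ≤ T := by
      have := div_pos hvq (neg_pos.2 hq)
      linarith
    have h1 := le_of_hasDerivAt_nonneg (f := fun r => w q * r - v r) (f' := fun r => w q * 1 - w r)
      hqT (fun r hr => ((hasDerivAt_id r).const_mul _).sub (hvd r (hq1.le.trans hr.1)))
      (fun r hr => by
        rcases hr.1.eq_or_lt with h | h
        · subst h; simp
        · have := hwanti q r hq1.le h
          linarith)
    have h2 := hvpos T (hq1.trans_le hqT)
    have h3 : w q * T = w q * q - v q := by
      have := hq.ne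
      rw [hT]; field_simp; ring
    linarith
  refine ⟨w, fun t => -(B * v t), hw1, by simp [hv1], hwpos,
    fun t ht => neg_neg_of_pos (mul_pos hB (hvpos t ht)), fun t ht => ⟨?_, ?_⟩⟩
  · refine (hwd t ht).congr_deriv ?_
    ring
  · exact ((hvd t ht).const_mul B).neg

/-- Sturm comparison with the majorant: if `x'/x ≥ y'/y` at `τ`, then `x` stays positive. -/
lemma IsFlow.pos_of_wronskian_nonneg {a b G x u y η : ℝ → ℝ} {B t₀ τ : ℝ} (ha_pos : ∀ t, 0 < a t)
    (hG_nonneg : ∀ r, 0 ≤ G r) (hG_le : ∀ r, 0 ≤ r → G r ≤ r) (hB : 0 ≤ B)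
    (hbB : ∀ t, 1 ≤ t → b t ≤ B) (hx : IsFlow a b G t₀ x u) (ht₀ : t₀ ≤ 1)
    (hypos : ∀ t, 1 ≤ t → 0 < y t)
    (hy : ∀ t, 1 ≤ t → HasDerivAt y (η t / a t) t ∧ HasDerivAt η (-(B * y t)) t)
    (hτ : 1 ≤ τ) (hxτ : 0 < x τ) (hW : 0 ≤ u τ * y τ - x τ * η τ) {t : ℝ} (ht : τ ≤ t) :
    0 < x t := by
  by_contra hcon
  obtain ⟨T, hT, hxT, hpos⟩ := exists_first_zero ht
    (fun r hr => (hx r (ht₀.trans (hτ.trans hr.1))).1.continuousAt.continuousWithinAt) hxτ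
    (not_lt.1 hcon)
  have hx0 : ∀ r ∈ Icc τ T, 0 ≤ x r := fun r hr => by
    rcases hr.2.eq_or_lt with h | h
    · rw [h, hxT]
    · exact (hpos r ⟨hr.1, h⟩).le
  have hWr : ∀ r ∈ Icc τ T, 0 ≤ u r * y r - x r * η r := fun r hr => by
    refine hW.trans (le_of_hasDerivAt_nonneg (f := fun r => u r * y r - x r * η r) hr.1
      (fun q hq => ?_) (f' := fun q => (B * x q - b q * G (x q)) * y q) (fun q hq => ?_))
    · have hq1 := hτ.trans hq.1
      obtain ⟨h1, h2⟩ := hx q (ht₀.trans hq1)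
      obtain ⟨h3, h4⟩ := hy q hq1
      refine ((h2.mul h3).sub (h1.mul h4)).congr_deriv ?_
      ring
    · have hq1 := hτ.trans hq.1
      refine mul_nonneg ?_ (hypos q hq1).le
      have h5 := hx0 q ⟨hq.1, hq.2.trans hr.2⟩
      have h6 := mul_le_mul_of_nonneg_right (hbB q hq1) (hG_nonneg (x q))
      have h7 := mul_le_mul_of_nonneg_left (hG_le _ h5) hB
      linarith
  have := le_of_hasDerivAt_nonneg (f := fun r => x r / y r) hT.1.le
    (f' := fun r => (u r / a r * y r - x r * (η r / a r)) / y r ^ 2)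
    (fun r hr => (hx r (ht₀.trans (hτ.trans hr.1))).1.div (hy r (hτ.trans hr.1)).1
      (hypos r (hτ.trans hr.1)).ne')
    (fun r hr => by
      refine div_nonneg ?_ (sq_nonneg _)
      have e : u r / a r * y r - x r * (η r / a r) = (u r * y r - x r * η r) / a r := by ring
      rw [e]
      exact div_nonneg (hWr r hr) (ha_pos r).le)
  simp only [hxT, zero_div] at this
  exact absurd (div_pos hxτ (hypos τ hτ)) (not_lt.2 this)

/-- A flow with nonzero initial slope never vanishes together with its momentum. -/
lemma IsFlow.ne_zero_of_ne_zero {a b G x u : ℝ → ℝ} {t₀ T : ℝ} (ha : Continuous a)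
    (ha_pos : ∀ t, 0 < a t) (hb : Continuous b) (hG : ∀ r, |G r| ≤ |r|)
    (hx : IsFlow a b G t₀ x u) (hT : t₀ ≤ T) (hu : u t₀ ≠ 0) : x T ≠ 0 ∨ u T ≠ 0 := by
  by_contra! hcon
  have hkc : Continuous fun t => 1 / a t + |b t| :=
    (continuous_const.div ha fun t => (ha_pos t).ne').add hb.abs
  have h := le_of_hasDerivAt_nonneg hT
    (f := fun t => (x t * x t + u t * u t) * exp (∫ r in t₀..t, (1 / a r + |b r|)))
    (fun t ht => (((hx t ht.1).1.mul (hx t ht.1).1).add ((hx t ht.1).2.mul (hx t ht.1).2)).mul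
      (hkc.integral_hasStrictDerivAt t₀ t).hasDerivAt.exp)
    (fun t ht => by
      have he := exp_pos (∫ r in t₀..t, (1 / a r + |b r|))
      set e := exp (∫ r in t₀..t, (1 / a r + |b r|))
      have h1 : (u t / a t * x t + x t * (u t / a t) + (-(b t * G (x t)) * u t
          + u t * -(b t * G (x t)))) * e + (x t * x t + u t * u t) * (e * (1 / a t + |b t|))
          = ((x t + u t) ^ 2 * (1 / a t)
            + (|b t| * (x t * x t + u t * u t) - 2 * (b t * G (x t) * u t))) * e := by ring
      change 0 ≤ (u t / a t * x t + x t * (u t / a t) + (-(b t * G (x t)) * u t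
          + u t * -(b t * G (x t)))) * e + (x t * x t + u t * u t) * (e * (1 / a t + |b t|))
      rw [h1]
      refine mul_nonneg (add_nonneg (mul_nonneg (sq_nonneg _)
        (one_div_pos.2 (ha_pos t)).le) ?_) he.le
      have h2 : b t * G (x t) * u t ≤ |b t| * (|x t| * |u t|) := by
        refine (le_abs_self _).trans ?_
        rw [abs_mul, abs_mul, mul_assoc]
        exact mul_le_mul_of_nonneg_left
          (mul_le_mul_of_nonneg_right (hG _) (abs_nonneg _)) (abs_nonneg _)
      have h3 := mul_nonneg (abs_nonneg (b t)) (sq_nonneg (|x t| - |u t|))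
      have h4 := abs_mul_abs_self (x t)
      have h5 := abs_mul_abs_self (u t)
      rw [← h4, ← h5]
      linarith)
  simp only [hcon.1, hcon.2, intervalIntegral.integral_same, exp_zero] at h
  have : 0 < u t₀ * u t₀ := mul_self_pos.2 hu
  have := mul_self_nonneg (x t₀)
  linarith

lemma hasDerivAt_integral_one_div {a : ℝ → ℝ} (ha : Continuous a) (ha_pos : ∀ t, 0 < a t) (t : ℝ) :
    HasDerivAt (fun t => ∫ r in (0:ℝ)..t, 1 / a r) (1 / a t) t :=
  ((continuous_const.div ha fun t => (ha_pos t).ne').integral_hasStrictDerivAt 0 t).hasDerivAt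

lemma integral_one_div_strictMono {a : ℝ → ℝ} (ha : Continuous a) (ha_pos : ∀ t, 0 < a t) :
    StrictMono fun t => ∫ r in (0:ℝ)..t, 1 / a r := fun _ _ h =>
  lt_of_hasDerivAt_pos h (fun t _ => hasDerivAt_integral_one_div ha ha_pos t)
    fun t _ => one_div_pos.2 (ha_pos t)

section UnitInterval

variable {a b G x u : ℝ → ℝ}

lemma IsFlow.momentum_anti (hx : IsFlow a b G 0 x u) (hb0 : ∀ t ∈ Icc (0:ℝ) 1, 0 ≤ b t)
    (hG_nonneg : ∀ r, 0 ≤ G r) {p q : ℝ} (hp : 0 ≤ p) (hpq : p ≤ q) (hq : q ≤ 1) : u q ≤ u p := by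
  have := le_of_hasDerivAt_nonneg hpq (fun r hr => (hx r (hp.trans hr.1)).2.neg) (fun r hr => by
    rw [neg_neg]
    exact mul_nonneg (hb0 r ⟨hp.trans hr.1, hr.2.trans hq⟩) (hG_nonneg _))
  simpa using this

lemma IsFlow.sub_le (ha : Continuous a) (ha_pos : ∀ t, 0 < a t) (hx : IsFlow a b G 0 x u)
    (hb0 : ∀ t ∈ Icc (0:ℝ) 1, 0 ≤ b t) (hG_nonneg : ∀ r, 0 ≤ G r) {p q : ℝ} (hp : 0 ≤ p)
    (hpq : p ≤ q) (hq : q ≤ 1) :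
    x q - x p ≤ u p * ((∫ r in (0:ℝ)..q, 1 / a r) - ∫ r in (0:ℝ)..p, 1 / a r) := by
  have := le_of_hasDerivAt_nonneg (f := fun t => u p * (∫ r in (0:ℝ)..t, 1 / a r) - x t) hpq
    (fun r hr => ((hasDerivAt_integral_one_div ha ha_pos r).const_mul (u p)).sub
      (hx r (hp.trans hr.1)).1)
    (fun r hr => by
      have h := hx.momentum_anti hb0 hG_nonneg hp hr.1 (hr.2.trans hq)
      rw [mul_one_div, ← sub_div]
      exact div_nonneg (sub_nonneg.2 h) (ha_pos r).le)
  linarith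

lemma IsFlow.le_sub (ha : Continuous a) (ha_pos : ∀ t, 0 < a t) (hx : IsFlow a b G 0 x u)
    (hb0 : ∀ t ∈ Icc (0:ℝ) 1, 0 ≤ b t) (hG_nonneg : ∀ r, 0 ≤ G r) {p q : ℝ} (hp : 0 ≤ p)
    (hpq : p ≤ q) (hq : q ≤ 1) :
    u q * ((∫ r in (0:ℝ)..q, 1 / a r) - ∫ r in (0:ℝ)..p, 1 / a r) ≤ x q - x p := by
  have := le_of_hasDerivAt_nonneg (f := fun t => x t - u q * (∫ r in (0:ℝ)..t, 1 / a r)) hpq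
    (fun r hr => (hx r (hp.trans hr.1)).1.sub
      ((hasDerivAt_integral_one_div ha ha_pos r).const_mul (u q)))
    (fun r hr => by
      have h := hx.momentum_anti hb0 hG_nonneg (hp.trans hr.1) hr.2 hq
      rw [mul_one_div, ← sub_div]
      exact div_nonneg (sub_nonneg.2 h) (ha_pos r).le)
  linarith

lemma IsFlow.pos_of_endpoint_nonneg (ha : Continuous a) (ha_pos : ∀ t, 0 < a t)
    (hx : IsFlow a b G 0 x u) (hb0 : ∀ t ∈ Icc (0:ℝ) 1, 0 ≤ b t) (hG_nonneg : ∀ r, 0 ≤ G r)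
    (hx0 : x 0 = 0) (hu0 : 0 < u 0) (hx1 : 0 ≤ x 1) {t : ℝ} (ht : t ∈ Ioo (0:ℝ) 1) : 0 < x t := by
  rcases lt_or_ge (u t) 0 with hut | hut
  · have h1 := hx.sub_le ha ha_pos hb0 hG_nonneg ht.1.le ht.2.le le_rfl
    have h2 := integral_one_div_strictMono ha ha_pos ht.2
    simp only at h2
    have := mul_neg_of_neg_of_pos hut (sub_pos.2 h2)
    linarith
  · by_contra hcon
    have hmono : ∀ p q, 0 ≤ p → p ≤ q → q ≤ t → x p ≤ x q := fun p q hp hpq hq =>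
      le_of_hasDerivAt_nonneg hpq (fun r hr => (hx r (hp.trans hr.1)).1) fun r hr =>
        div_nonneg (hut.trans (hx.momentum_anti hb0 hG_nonneg (hp.trans hr.1) (hr.2.trans hq)
          ht.2.le)) (ha_pos r).le
    have hev : ∀ᶠ r in 𝓝 (0:ℝ), 0 < u r := (hx 0 le_rfl).2.continuousAt.eventually (lt_mem_nhds hu0)
    obtain ⟨δ, hδ, h⟩ := Metric.eventually_nhds_iff.1 hev
    set d := min t (δ / 2) with hd
    have hd0 : 0 < d := lt_min ht.1 (by linarith)
    have := lt_of_hasDerivAt_pos hd0 (fun r hr => (hx r hr.1).1) (fun r hr => by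
      refine div_pos (h ?_) (ha_pos r)
      rw [Real.dist_eq, sub_zero, abs_of_pos hr.1]
      have := hr.2.trans_le (min_le_right t (δ / 2))
      linarith)
    have := hmono d t hd0.le (min_le_left _ _) le_rfl
    linarith

lemma IsFlow.le_of_mem_Icc (ha : Continuous a) (ha_pos : ∀ t, 0 < a t)
    (hx : IsFlow a b G 0 x u) (hb0 : ∀ t ∈ Icc (0:ℝ) 1, 0 ≤ b t) (hG_nonneg : ∀ r, 0 ≤ G r)
    (hx0 : x 0 = 0) (hu0 : 0 < u 0) {t : ℝ} (ht : t ∈ Icc (0:ℝ) 1) :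
    x t ≤ u 0 * ∫ r in (0:ℝ)..1, 1 / a r := by
  have h1 := hx.sub_le ha ha_pos hb0 hG_nonneg le_rfl ht.1 ht.2
  rw [hx0, sub_zero, intervalIntegral.integral_same, sub_zero] at h1
  exact h1.trans (mul_le_mul_of_nonneg_left
    ((integral_one_div_strictMono ha ha_pos).monotone ht.2) hu0.le)

/-- A slope that dominates the total forcing on `[0, 1]` gives a solution still rising at `1`. -/
lemma IsFlow.rising_at_one (ha : Continuous a) (ha_pos : ∀ t, 0 < a t) (hb : Continuous b)
    (hx : IsFlow a b G 0 x u) (hb0 : ∀ t ∈ Icc (0:ℝ) 1, 0 ≤ b t) (hG_nonneg : ∀ r, 0 ≤ G r)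
    (hG_mono : Monotone G) (hx0 : x 0 = 0) (hu0 : 0 < u 0)
    (hs : G (u 0 * ∫ r in (0:ℝ)..1, 1 / a r) * (∫ r in (0:ℝ)..1, b r) < u 0) :
    0 < x 1 ∧ 0 ≤ u 1 := by
  set c := G (u 0 * ∫ r in (0:ℝ)..1, 1 / a r) with hc
  have h1 := le_of_hasDerivAt_nonneg (f := fun t => u t + c * ∫ r in (0:ℝ)..t, b r) zero_le_one
    (fun r hr => (hx r hr.1).2.add ((hb.integral_hasStrictDerivAt 0 r).hasDerivAt.const_mul c))
    (fun r hr => by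
      have h2 : G (x r) ≤ c := hG_mono (hx.le_of_mem_Icc ha ha_pos hb0 hG_nonneg hx0 hu0 hr)
      have := mul_le_mul_of_nonneg_left h2 (hb0 r hr)
      linarith)
  simp only [intervalIntegral.integral_same, mul_zero, add_zero] at h1
  have hu1 : 0 < u 1 := by linarith
  refine ⟨?_, hu1.le⟩
  have := lt_of_hasDerivAt_pos zero_lt_one (fun r hr => (hx r hr.1).1) (fun r hr =>
    div_pos (hu1.trans_le (hx.momentum_anti hb0 hG_nonneg hr.1.le hr.2.le le_rfl)) (ha_pos r))
  rwa [hx0] at this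

lemma IsFlow.min_le_of_mem_Icc (ha_pos : ∀ t, 0 < a t)
    (hx : IsFlow a b G 0 x u) (hb0 : ∀ t ∈ Icc (0:ℝ) 1, 0 ≤ b t) (hG_nonneg : ∀ r, 0 ≤ G r)
    {t₁ t₂ t : ℝ} (ht₁ : 0 ≤ t₁) (ht₂ : t₂ ≤ 1) (ht : t ∈ Icc t₁ t₂) :
    min (x t₁) (x t₂) ≤ x t := by
  rcases le_total 0 (u t) with h | h
  · refine (min_le_left _ _).trans ?_
    exact le_of_hasDerivAt_nonneg ht.1 (fun r hr => (hx r (ht₁.trans hr.1)).1) fun r hr =>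
      div_nonneg (h.trans (hx.momentum_anti hb0 hG_nonneg (ht₁.trans hr.1) hr.2
        (ht.2.trans ht₂))) (ha_pos r).le
  · refine (min_le_right _ _).trans ?_
    have := le_of_hasDerivAt_nonneg ht.2
      (fun r hr => (hx r (ht₁.trans (ht.1.trans hr.1))).1.neg) fun r hr => by
        rw [← neg_div]
        exact div_nonneg (neg_nonneg.2 ((hx.momentum_anti hb0 hG_nonneg (ht₁.trans ht.1) hr.1
          (hr.2.trans ht₂)).trans h)) (ha_pos r).le
    simpa using this

/-- Strong forcing on `[t₁, t₂]` is incompatible with nonnegativity at `1`. -/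
lemma IsFlow.forcing_le (ha : Continuous a) (ha_pos : ∀ t, 0 < a t) (hb : Continuous b)
    (hx : IsFlow a b G 0 x u) (hb0 : ∀ t ∈ Icc (0:ℝ) 1, 0 ≤ b t) (hG_nonneg : ∀ r, 0 ≤ G r)
    (hx0 : x 0 = 0) (hu0 : 0 < u 0) (hx1 : 0 ≤ x 1) {t₁ t₂ κ : ℝ} (ht₁ : t₁ ∈ Ioo (0:ℝ) 1)
    (ht₂ : t₂ ∈ Ioo (0:ℝ) 1) (ht₁₂ : t₁ < t₂) (hκ : 0 ≤ κ)
    (hGκ : ∀ t ∈ Icc t₁ t₂, κ * x t ≤ G (x t)) :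
    κ * (∫ t in t₁..t₂, b t) ≤ (∫ s in (0:ℝ)..1, 1 / a s) /
        ((∫ s in (0:ℝ)..t₁, 1 / a s) *
          ((∫ s in (0:ℝ)..1, 1 / a s) - ∫ s in (0:ℝ)..t₂, 1 / a s)) := by
  have hA := integral_one_div_strictMono ha ha_pos
  have e1 := hx.le_sub ha ha_pos hb0 hG_nonneg le_rfl ht₁.1.le ht₁.2.le
  have e2 := hx.sub_le ha ha_pos hb0 hG_nonneg ht₂.1.le ht₂.2.le le_rfl
  have e3 := hx.sub_le ha ha_pos hb0 hG_nonneg ht₁.1.le ht₁₂.le ht₂.2.le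
  have e4 := hx.le_sub ha ha_pos hb0 hG_nonneg ht₁.1.le ht₁₂.le ht₂.2.le
  rw [hx0, sub_zero, intervalIntegral.integral_same, sub_zero] at e1
  have hα := hA ht₁.1
  have hαβ := hA ht₁₂
  have hβγ := hA ht₂.2
  simp only [intervalIntegral.integral_same] at hα hαβ hβγ
  have hx₁ := hx.pos_of_endpoint_nonneg ha ha_pos hb0 hG_nonneg hx0 hu0 hx1 ht₁
  have hx₂ := hx.pos_of_endpoint_nonneg ha ha_pos hb0 hG_nonneg hx0 hu0 hx1 ht₂
  set α := ∫ s in (0:ℝ)..t₁, 1 / a s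
  set β := ∫ s in (0:ℝ)..t₂, 1 / a s
  set γ := ∫ s in (0:ℝ)..1, 1 / a s
  set m := min (x t₁) (x t₂) with hm
  have hm0 : 0 < m := lt_min hx₁ hx₂
  have h1 : κ * m * (∫ t in t₁..t₂, b t) ≤ u t₁ - u t₂ := by
    have := le_of_hasDerivAt_nonneg (f := fun t => -u t - κ * m * ∫ r in t₁..t, b r) ht₁₂.le
      (fun r hr => (hx r (ht₁.1.le.trans hr.1)).2.neg.sub
        ((hb.integral_hasStrictDerivAt t₁ r).hasDerivAt.const_mul (κ * m)))
      (fun r hr => by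
        have h2 : κ * m ≤ G (x r) := (mul_le_mul_of_nonneg_left
          (hx.min_le_of_mem_Icc ha_pos hb0 hG_nonneg ht₁.1.le ht₂.2.le hr) hκ).trans (hGκ r hr)
        have := mul_le_mul_of_nonneg_left h2 (hb0 r ⟨ht₁.1.le.trans hr.1, hr.2.trans ht₂.2.le⟩)
        linarith)
    simp only [intervalIntegral.integral_same, mul_zero, sub_zero] at this
    linarith
  have h2 : (u t₁ - u t₂) * (α * (γ - β)) ≤ x t₁ * γ := by
    have f1 : -u t₂ * (γ - β) ≤ x t₂ := by linarith
    have f2 := mul_le_mul_of_nonneg_left f1 hα.le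
    have f3 := mul_le_mul_of_nonneg_left e3 hα.le
    have f4 := mul_le_mul_of_nonneg_right e1 (show 0 ≤ γ - α by linarith)
    linarith
  have h3 : (u t₁ - u t₂) * (α * (γ - β)) ≤ x t₂ * γ := by
    have f1 : -u t₂ * (γ - β) ≤ x t₂ := by linarith
    have f2 := mul_le_mul_of_nonneg_right e1 (show 0 ≤ γ - β by linarith)
    have f3 := mul_le_mul_of_nonneg_right e4 (show 0 ≤ γ - β by linarith)
    have f4 := mul_le_mul_of_nonneg_right f1 (show 0 ≤ β by linarith)
    linarith
  have h4 : (u t₁ - u t₂) * (α * (γ - β)) ≤ m * γ := by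
    rcases min_choice (x t₁) (x t₂) with h | h <;> rw [hm, h] <;> assumption
  have hpos : 0 < α * (γ - β) := mul_pos hα (by linarith)
  rw [le_div_iff₀ hpos]
  have h5 := (mul_le_mul_of_nonneg_right h1 hpos.le).trans h4
  refine le_of_mul_le_mul_left ?_ hm0
  linarith

/-- Solutions nonnegative at `1` are bounded below on `[t₁, t₂]` proportionally to their initial
slope. -/
lemma exists_slope_le (ha : Continuous a) (ha_pos : ∀ t, 0 < a t) (hb : Continuous b)
    (hb0 : ∀ t ∈ Icc (0:ℝ) 1, 0 ≤ b t) (hG_nonneg : ∀ r, 0 ≤ G r) (hG_le : ∀ r, 0 ≤ r → G r ≤ r)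
    {t₁ t₂ : ℝ} (ht₁ : t₁ ∈ Ioo (0:ℝ) 1) (ht₂ : t₂ ∈ Ioo (0:ℝ) 1) (ht₁₂ : t₁ < t₂) :
    ∃ c, 0 < c ∧ ∀ x u : ℝ → ℝ, IsFlow a b G 0 x u → x 0 = 0 → 0 < u 0 → 0 ≤ x 1 →
      ∀ t ∈ Icc t₁ t₂, u 0 ≤ c * x t := by
  have hA := integral_one_div_strictMono ha ha_pos
  have hα := hA ht₁.1
  have hαβ := hA ht₁₂
  have hβγ := hA ht₂.2
  simp only [intervalIntegral.integral_same] at hα hαβ hβγ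
  set α := ∫ s in (0:ℝ)..t₁, 1 / a s with hαdef
  set β := ∫ s in (0:ℝ)..t₂, 1 / a s with hβdef
  set γ := ∫ s in (0:ℝ)..1, 1 / a s with hγdef
  set I := ∫ r in (0:ℝ)..t₁, b r with hI
  have hI0 : 0 ≤ I := intervalIntegral.integral_nonneg ht₁.1.le
    fun r hr => hb0 r ⟨hr.1, hr.2.trans ht₁.2.le⟩
  have hγα : 0 < γ - α := by linarith
  have hγβ : 0 < γ - β := by linarith
  have hγ : 0 < γ := by linarith
  have hK : 0 < 1 / α + γ / (γ - α) * I := by positivity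
  set K := 1 / α + γ / (γ - α) * I with hKdef
  refine ⟨K * ((γ - α) / (γ - β)), by positivity, fun x u hx hx0 hu0 hx1 t ht => ?_⟩
  have e1 := hx.le_sub ha ha_pos hb0 hG_nonneg le_rfl ht₁.1.le ht₁.2.le
  have e2 := hx.sub_le ha ha_pos hb0 hG_nonneg ht₂.1.le ht₂.2.le le_rfl
  have e4 := hx.le_sub ha ha_pos hb0 hG_nonneg ht₁.1.le ht₁₂.le ht₂.2.le
  have e5 := hx.sub_le ha ha_pos hb0 hG_nonneg ht₁.1.le ht₁.2.le le_rfl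
  have hx₁ := hx.pos_of_endpoint_nonneg ha ha_pos hb0 hG_nonneg hx0 hu0 hx1 ht₁
  rw [hx0, sub_zero, intervalIntegral.integral_same, sub_zero] at e1
  rw [← hαdef, ← hβdef] at e4
  rw [← hγdef, ← hβdef] at e2
  rw [← hγdef, ← hαdef] at e5
  rw [← hαdef] at e1
  have hbd : ∀ r ∈ Icc 0 t₁, x r ≤ x t₁ * (γ / (γ - α)) := fun r hr => by
    have e6 := hx.le_sub ha ha_pos hb0 hG_nonneg hr.1 hr.2 ht₁.2.le
    have hr0 : 0 ≤ ∫ s in (0:ℝ)..r, 1 / a s := by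
      have := hA.monotone hr.1
      simpa using this
    have hrα : ∫ s in (0:ℝ)..r, 1 / a s ≤ α := hA.monotone hr.2
    rw [← hαdef] at e6
    set ρ := ∫ s in (0:ℝ)..r, 1 / a s
    rw [← mul_div_assoc, le_div_iff₀ hγα]
    have f1 : -u t₁ * (γ - α) ≤ x t₁ := by linarith
    have f2 := mul_le_mul_of_nonneg_right f1 (show 0 ≤ α - ρ by linarith)
    have f3 := mul_le_mul_of_nonneg_right e6 hγα.le
    have f4 := mul_nonneg hx₁.le hr0
    linarith
  have hu₁ : u 0 - x t₁ * (γ / (γ - α)) * I ≤ u t₁ := by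
    have := le_of_hasDerivAt_nonneg
      (f := fun t => u t + x t₁ * (γ / (γ - α)) * ∫ r in (0:ℝ)..t, b r) ht₁.1.le
      (fun r hr => (hx r hr.1).2.add
        ((hb.integral_hasStrictDerivAt 0 r).hasDerivAt.const_mul _))
      (fun r hr => by
        have hxr : 0 ≤ x r := by
          rcases hr.1.eq_or_lt with h | h
          · rw [← h, hx0]
          · exact (hx.pos_of_endpoint_nonneg ha ha_pos hb0 hG_nonneg hx0 hu0 hx1
              ⟨h, hr.2.trans_lt ht₁.2⟩).le
        have := mul_le_mul_of_nonneg_left ((hG_le _ hxr).trans (hbd r hr))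
          (hb0 r ⟨hr.1, hr.2.trans ht₁.2.le⟩)
        linarith)
    simp only [intervalIntegral.integral_same, mul_zero, add_zero] at this
    linarith
  have hs : u 0 ≤ K * x t₁ := by
    have f1 := mul_le_mul_of_nonneg_right hu₁ hα.le
    have f2 : u t₁ ≤ x t₁ / α := by rwa [le_div_iff₀ hα]
    rw [hKdef]
    have : (1 / α + γ / (γ - α) * I) * x t₁ = x t₁ / α + x t₁ * (γ / (γ - α)) * I := by ring
    linarith
  have hx12 : x t₁ * (γ - β) ≤ x t₂ * (γ - α) := by
    have f1 : -u t₂ * (γ - β) ≤ x t₂ := by linarith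
    have f2 := mul_le_mul_of_nonneg_right f1 (show 0 ≤ β - α by linarith)
    have f3 := mul_le_mul_of_nonneg_right e4 hγβ.le
    linarith
  have hxt : x t₁ ≤ (γ - α) / (γ - β) * x t := by
    have h := hx.min_le_of_mem_Icc ha_pos hb0 hG_nonneg ht₁.1.le ht₂.2.le ht
    rw [div_mul_eq_mul_div, le_div_iff₀ hγβ]
    rcases min_choice (x t₁) (x t₂) with h' | h' <;> rw [h'] at h
    · have f1 := mul_le_mul_of_nonneg_left h hγα.le
      have f2 := mul_nonneg hx₁.le (show 0 ≤ β - α by linarith)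
      linarith
    · have f1 := mul_le_mul_of_nonneg_left h hγα.le
      linarith
  rw [mul_assoc]
  exact hs.trans (mul_le_mul_of_nonneg_left hxt hK.le)

end UnitInterval

section HalfLine

variable {a b G y η : ℝ → ℝ} {B : ℝ}

lemma mul_le_mul_of_weight_le {b g B x : ℝ} (hb : b ≤ B) (hB : 0 ≤ B) (hg : 0 ≤ g) (hgx : g ≤ x) :
    0 ≤ B * x - b * g := by
  have h1 := mul_le_mul_of_nonneg_right hb hg
  have h2 := mul_le_mul_of_nonneg_left hgx hB
  linarith

/-- If the logarithmic derivative of `x` stays below that of `y`, then `x / y` decreases. -/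
lemma IsFlow.le_mul_of_wronskian_nonpos {x u : ℝ → ℝ} {t₀ T : ℝ} (ha_pos : ∀ t, 0 < a t)
    (hx : IsFlow a b G t₀ x u) (ht₀ : t₀ ≤ 1) (hy1 : y 1 = 1) (hypos : ∀ t, 1 ≤ t → 0 < y t)
    (hy : ∀ t, 1 ≤ t → HasDerivAt y (η t / a t) t ∧ HasDerivAt η (-(B * y t)) t) (hT : 1 ≤ T)
    (hW : ∀ t ∈ Icc 1 T, u t * y t - x t * η t ≤ 0) : x T ≤ x 1 * y T := by
  have := le_of_hasDerivAt_nonneg (f := fun r => -(x r / y r)) hT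
    (f' := fun r => -((u r / a r * y r - x r * (η r / a r)) / y r ^ 2))
    (fun r hr => ((hx r (ht₀.trans hr.1)).1.div (hy r hr.1).1 (hypos r hr.1).ne').neg)
    (fun r hr => by
      have e : -((u r / a r * y r - x r * (η r / a r)) / y r ^ 2)
          = -(u r * y r - x r * η r) / a r / y r ^ 2 := by ring
      rw [e]
      exact div_nonneg (div_nonneg (neg_nonneg.2 (hW r hr)) (ha_pos r).le) (sq_nonneg _))
  simp only [hy1, div_one] at this
  rwa [neg_le_neg_iff, div_le_iff₀ (hypos T hT)] at this

/-- A positive limit of solutions that eventually vanish is a principal solution. -/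
lemma not_integrableOn_of_limit_of_vanishing {x u : ℝ → ℝ} {xn un : ℕ → ℝ → ℝ}
    (ha : Continuous a) (ha_pos : ∀ t, 0 < a t) (hb : Continuous b) (hG : Continuous G)
    (hG_nonneg : ∀ r, 0 ≤ G r) (hG_le : ∀ r, 0 ≤ r → G r ≤ r) (hB : 0 ≤ B)
    (hbB : ∀ t, 1 ≤ t → b t ≤ B)
    (hy1 : y 1 = 1) (hη1 : η 1 = 0) (hypos : ∀ t, 1 ≤ t → 0 < y t)
    (hy : ∀ t, 1 ≤ t → HasDerivAt y (η t / a t) t ∧ HasDerivAt η (-(B * y t)) t)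
    (hx : IsFlow a b G 1 x u) (hxn : ∀ n, IsFlow a b G 1 (xn n) (un n))
    (hxlim : ∀ t, 1 ≤ t → Tendsto (fun n => xn n t) atTop (𝓝 (x t)))
    (hulim : Tendsto (fun n => un n 1) atTop (𝓝 (u 1)))
    (hxpos : ∀ t, 1 ≤ t → 0 < x t)
    (hW : ∀ t, 1 ≤ t → u t * y t - x t * η t ≤ 0)
    (hvanish : ∀ᶠ n in atTop, ∃ T, 1 ≤ T ∧ xn n T = 0 ∧ (∀ t ∈ Icc 1 T, 0 ≤ xn n t) ∧
      ∀ t ∈ Icc 1 T, un n t * y t - xn n t * η t ≤ 0) :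
    ¬ IntegrableOn (fun t => 1 / (a t * x t ^ 2)) (Ici 1) := by
  intro hint_x
  have hxc : ContinuousOn x (Ici 1) := fun t ht => (hx t ht).1.continuousAt.continuousWithinAt
  have hyc : ContinuousOn y (Ici 1) := fun t ht => (hy t ht).1.continuousAt.continuousWithinAt
  have hxnc : ∀ n, ContinuousOn (xn n) (Ici 1) := fun n t ht =>
    (hxn n t ht).1.continuousAt.continuousWithinAt
  have huc : ContinuousOn u (Ici 1) := fun t ht => (hx t ht).2.continuousAt.continuousWithinAt
  have hunc : ∀ n, ContinuousOn (un n) (Ici 1) := fun n t ht =>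
    (hxn n t ht).2.continuousAt.continuousWithinAt
  have hGx : ContinuousOn (fun t => G (x t)) (Ici 1) := hG.comp_continuousOn hxc
  have hGxn : ∀ n, ContinuousOn (fun t => G (xn n t)) (Ici 1) := fun n =>
    hG.comp_continuousOn (hxnc n)
  have hsub : ∀ {t : ℝ}, 1 ≤ t → uIcc 1 t ⊆ Ici 1 := fun ht => by
    rw [uIcc_of_le ht]; exact Icc_subset_Ici_self
  set g : ℝ → ℝ := fun t => (B * x t - b t * G (x t)) * y t with hg
  have hgc : ContinuousOn g (Ici 1) :=
    ((continuousOn_const.mul hxc).sub (hb.continuousOn.mul hGx)).mul hyc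
  have hwt : ∀ t, 1 ≤ t → 0 ≤ B * x t - b t * G (x t) := fun t ht =>
    mul_le_mul_of_weight_le (hbB t ht) hB (hG_nonneg _) (hG_le _ (hxpos t ht).le)
  have hg0 : ∀ t, 1 ≤ t → 0 ≤ g t := fun t ht => mul_nonneg (hwt t ht) (hypos t ht).le
  have hWd : ∀ t, 1 ≤ t → HasDerivAt (fun t => u t * y t - x t * η t) (g t) t := fun t ht => by
    refine (((hx t ht).2.mul (hy t ht).1).sub ((hx t ht).1.mul (hy t ht).2)).congr_deriv ?_
    simp only [hg]; ring
  have hgint : IntegrableOn g (Ioi 1) := by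
    refine integrableOn_Ioi_of_intervalIntegral_norm_bounded (-u 1) 1
      (fun i : ℝ => ?_) tendsto_id ?_
    · exact ((hgc.mono Icc_subset_Ici_self).integrableOn_Icc).mono_set Ioc_subset_Icc_self
    · filter_upwards [eventually_ge_atTop 1] with T hT
      have e : ∫ t in (1:ℝ)..id T, ‖g t‖ = ∫ t in (1:ℝ)..T, g t :=
        intervalIntegral.integral_congr fun t ht => by
          simp only [Real.norm_eq_abs]
          exact abs_of_nonneg (hg0 t (hsub hT ht))
      rw [e, intervalIntegral.integral_eq_sub_of_hasDerivAt (fun t ht => hWd t (hsub hT ht))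
        (hgc.mono (hsub hT)).intervalIntegrable, hy1, hη1]
      have := hW T hT
      linarith
  set M := x 1 + 1 with hM
  have hM0 : 0 < M := by have := hxpos 1 le_rfl; linarith
  set V' : ℕ → ℝ → ℝ := fun n t => xn n t * (b t * G (x t)) - b t * G (xn n t) * x t with hV'
  have hVc : ∀ n, ContinuousOn (V' n) (Ici 1) := fun n =>
    ((hxnc n).mul (hb.continuousOn.mul hGx)).sub ((hb.continuousOn.mul (hGxn n)).mul hxc)
  set N : ℕ → ℝ → ℝ := fun n t => min (max (-V' n t) 0) (M * g t) with hN
  have hNc : ∀ n, ContinuousOn (N n) (Ici 1) := fun n =>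
    ((hVc n).neg.sup continuousOn_const).inf (continuousOn_const.mul hgc)
  have hN0 : ∀ n t, 1 ≤ t → 0 ≤ N n t := fun n t ht =>
    le_min (le_max_right _ _) (mul_nonneg hM0.le (hg0 t ht))
  have hNle : ∀ n t, 1 ≤ t → N n t ≤ M * g t := fun n t ht => min_le_right _ _
  have hNmeas : ∀ n, AEStronglyMeasurable (N n) (volume.restrict (Ioi 1)) := fun n =>
    ((hNc n).mono Ioi_subset_Ici_self).aestronglyMeasurable measurableSet_Ioi
  have hNbd : ∀ n, ∀ᵐ t ∂volume.restrict (Ioi (1:ℝ)), ‖N n t‖ ≤ M * g t := fun n => by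
    filter_upwards [ae_restrict_mem measurableSet_Ioi] with t ht
    rw [Real.norm_eq_abs, abs_of_nonneg (hN0 n t (le_of_lt ht))]
    exact hNle n t (le_of_lt ht)
  have hNint : ∀ n, IntegrableOn (N n) (Ioi 1) := fun n =>
    Integrable.mono' (hgint.const_mul M) (hNmeas n) (hNbd n)
  have hNlim : Tendsto (fun n => ∫ t in Ioi (1:ℝ), N n t) atTop (𝓝 0) := by
    have := tendsto_integral_of_dominated_convergence (f := fun _ => (0:ℝ))
      (fun t => M * g t) hNmeas (hgint.const_mul M) hNbd (by
        filter_upwards [ae_restrict_mem measurableSet_Ioi] with t ht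
        have h1 := hxlim t (le_of_lt ht)
        have h2 : Tendsto (fun n => V' n t) atTop
            (𝓝 (x t * (b t * G (x t)) - b t * G (x t) * x t)) :=
          (h1.mul_const _).sub ((((hG.tendsto _).comp h1).const_mul _).mul_const _)
        have h3 : Tendsto (fun n => N n t) atTop
            (𝓝 (min (max (-(x t * (b t * G (x t)) - b t * G (x t) * x t)) 0) (M * g t))) :=
          (h2.neg.max tendsto_const_nhds).min tendsto_const_nhds
        have e : x t * (b t * G (x t)) - b t * G (x t) * x t = 0 := by ring
        rw [e, neg_zero, max_self, min_eq_left (mul_nonneg hM0.le (hg0 t (le_of_lt ht)))] at h3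
        exact h3)
    simpa using this
  set V1 : ℕ → ℝ := fun n => un n 1 * x 1 - xn n 1 * u 1 with hV1
  have hV1lim : Tendsto V1 atTop (𝓝 0) := by
    have := (hulim.mul_const (x 1)).sub ((hxlim 1 le_rfl).mul_const (u 1))
    rwa [show u 1 * x 1 - x 1 * u 1 = 0 by ring] at this
  set δ : ℕ → ℝ := fun n => |V1 n| + ∫ t in Ioi (1:ℝ), N n t with hδ
  have hδlim : Tendsto δ atTop (𝓝 0) := by
    simpa using hV1lim.abs.add hNlim
  have hδ0 : ∀ n, 0 ≤ δ n := fun n => add_nonneg (abs_nonneg _)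
    (setIntegral_nonneg measurableSet_Ioi fun t ht => hN0 n t (le_of_lt ht))
  have hIpos : ∀ t, 1 ≤ t → 0 ≤ 1 / (a t * x t ^ 2) := fun t _ =>
    one_div_nonneg.2 (mul_nonneg (ha_pos t).le (sq_nonneg _))
  have hIc : ContinuousOn (fun t => 1 / (a t * x t ^ 2)) (Ici 1) :=
    continuousOn_const.div (ha.continuousOn.mul (hxc.pow 2)) fun t ht =>
      (mul_pos (ha_pos t) (pow_pos (hxpos t ht) 2)).ne'
  have hIoi : IntegrableOn (fun t => 1 / (a t * x t ^ 2)) (Ioi 1) :=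
    hint_x.mono_set Ioi_subset_Ici_self
  set K := ∫ t in Ioi (1:ℝ), 1 / (a t * x t ^ 2) with hK
  have hle : ∀ {f : ℝ → ℝ}, IntegrableOn f (Ioi 1) → (∀ t, 1 ≤ t → 0 ≤ f t) → ∀ t, 1 ≤ t →
      ∫ r in (1:ℝ)..t, f r ≤ ∫ r in Ioi (1:ℝ), f r := fun {f} hf hf0 t ht => by
    rw [intervalIntegral.integral_of_le ht]
    refine setIntegral_mono_set hf ?_ Ioc_subset_Ioi_self.eventuallyLE
    filter_upwards [ae_restrict_mem measurableSet_Ioi] with r hr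
    exact hf0 r (le_of_lt hr)
  have hkey : ∀ᶠ n in atTop, xn n 1 / x 1 ≤ δ n * K := by
    have hM1 : ∀ᶠ n in atTop, xn n 1 < M :=
      (hxlim 1 le_rfl).eventually (gt_mem_nhds (by rw [hM]; linarith))
    filter_upwards [hvanish, hM1] with n ⟨T, hT, hxT, hnn, hWn⟩ hn1
    have hVN : ∀ t ∈ Icc 1 T, -N n t ≤ V' n t := fun t ht => by
      have h1 : xn n t ≤ M * y t :=
        ((hxn n).le_mul_of_wronskian_nonpos ha_pos le_rfl hy1 hypos hy ht.1
          (fun r hr => hWn r ⟨hr.1, hr.2.trans ht.2⟩)).trans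
          (mul_le_mul_of_nonneg_right hn1.le (hypos t ht.1).le)
      have h2 : -V' n t ≤ M * g t := by
        have h3 := mul_le_mul_of_nonneg_left h1 (hwt t ht.1)
        have h4 := mul_nonneg (mul_le_mul_of_weight_le (hbB t ht.1) hB (hG_nonneg (xn n t))
          (hG_le _ (hnn t ht))) (hxpos t ht.1).le
        simp only [hV', hg]
        linarith
      have h5 : -V' n t ≤ N n t := le_min (le_max_left _ _) h2
      linarith
    have hVd : ∀ t, 1 ≤ t → HasDerivAt (fun t => un n t * x t - xn n t * u t) (V' n t) t :=
      fun t ht => by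
        refine (((hxn n t ht).2.mul (hx t ht).1).sub
          ((hxn n t ht).1.mul (hx t ht).2)).congr_deriv ?_
        simp only [hV']; ring
    have hV : ∀ t ∈ Icc 1 T, -δ n ≤ un n t * x t - xn n t * u t := fun t ht => by
      have h1 := intervalIntegral.integral_eq_sub_of_hasDerivAt
        (fun r hr => hVd r (hsub ht.1 hr)) ((hVc n).mono (hsub ht.1)).intervalIntegrable
      have h2 : ∫ r in (1:ℝ)..t, -N n r ≤ ∫ r in (1:ℝ)..t, V' n r :=
        intervalIntegral.integral_mono_on ht.1 ((hNc n).neg.mono (hsub ht.1)).intervalIntegrable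
          ((hVc n).mono (hsub ht.1)).intervalIntegrable
          fun r hr => hVN r ⟨hr.1, hr.2.trans ht.2⟩
      rw [intervalIntegral.integral_neg] at h2
      have h3 := hle (hNint n) (hN0 n) t ht.1
      have h4 := neg_abs_le (V1 n)
      simp only [hδ]
      simp only [hV1] at h4 ⊢
      linarith
    have hqc : ContinuousOn (fun t => (un n t / a t * x t - xn n t * (u t / a t)) / x t ^ 2)
        (Ici 1) :=
      (((((hunc n).div ha.continuousOn fun t _ => (ha_pos t).ne').mul hxc).sub
        ((hxnc n).mul (huc.div ha.continuousOn fun t _ => (ha_pos t).ne'))).div (hxc.pow 2)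
        fun t ht => (pow_pos (hxpos t ht) 2).ne')
    have h1 := intervalIntegral.integral_eq_sub_of_hasDerivAt
      (fun r hr => (hxn n r (hsub hT hr)).1.div (hx r (hsub hT hr)).1
        (hxpos r (hsub hT hr)).ne') (hqc.mono (hsub hT)).intervalIntegrable
    have h2 : ∫ r in (1:ℝ)..T, -δ n * (1 / (a r * x r ^ 2))
        ≤ ∫ r in (1:ℝ)..T, (un n r / a r * x r - xn n r * (u r / a r)) / x r ^ 2 := by
      refine intervalIntegral.integral_mono_on hT
        ((continuousOn_const.mul hIc).mono (hsub hT)).intervalIntegrable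
        (hqc.mono (hsub hT)).intervalIntegrable fun r hr => ?_
      have h3 := mul_le_mul_of_nonneg_right (hV r hr) (hIpos r hr.1)
      refine h3.trans (le_of_eq ?_)
      have := (ha_pos r).ne'
      have := (hxpos r hr.1).ne'
      field_simp
    rw [intervalIntegral.integral_const_mul] at h2
    have h3 := mul_le_mul_of_nonneg_left (hle hIoi hIpos T hT) (hδ0 n)
    rw [h1] at h2
    simp only [Pi.div_apply, hxT, zero_div, zero_sub] at h2
    linarith
  have hlim1 : Tendsto (fun n => xn n 1 / x 1) atTop (𝓝 1) := by
    have := (hxlim 1 le_rfl).div_const (x 1)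
    rwa [div_self (hxpos 1 le_rfl).ne'] at this
  have hlim2 : Tendsto (fun n => δ n * K) atTop (𝓝 0) := by
    simpa using hδlim.mul_const K
  exact absurd (le_of_tendsto_of_tendsto hlim1 hlim2 hkey) (by norm_num)

end HalfLine

/-- Shooting: if one slope leads to a negative value at `1` and another one to a solution rising
at `1`, then some intermediate slope gives a positive principal solution, decreasing
on `[1, ∞)`. -/
lemma exists_principal_flow {a b G : ℝ → ℝ} {B : ℝ} (ha : Continuous a) (ha_pos : ∀ t, 0 < a t)
    (hb : Continuous b) (hb0 : ∀ t ∈ Icc (0:ℝ) 1, 0 ≤ b t) (hG : LipschitzWith 1 G)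
    (hG_nonneg : ∀ r, 0 ≤ G r) (hG0 : G 0 = 0) (hB : 0 < B) (hbB : ∀ t, 1 ≤ t → b t ≤ B)
    (hdisc : Disconjugate2 (fun t => B / a t) (Ici 1))
    (hrise : ∃ s, 0 < s ∧ ∀ x u, IsFlow a b G 0 x u → x 0 = 0 → u 0 = s → 0 < x 1 ∧ 0 ≤ u 1)
    (hcross : ∃ s, 0 < s ∧ ∀ x u, IsFlow a b G 0 x u → x 0 = 0 → u 0 = s → x 1 < 0) :
    ∃ x u, IsFlow a b G 0 x u ∧ x 0 = 0 ∧ (∀ t, 0 < t → 0 < x t) ∧ (∀ t, 1 < t → u t < 0) ∧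
      ¬ IntegrableOn (fun t => 1 / (a t * x t ^ 2)) (Ici 1) := by
  have hG_abs : ∀ r, |G r| ≤ |r| := fun r => by
    have := hG.dist_le_mul r 0
    simpa [Real.dist_eq, hG0] using this
  have hG_le : ∀ r, 0 ≤ r → G r ≤ r := fun r hr =>
    (le_abs_self _).trans ((hG_abs r).trans_eq (abs_of_nonneg hr))
  obtain ⟨y, η, hy1, hη1, hypos, hηneg, hy⟩ := exists_positive_majorant ha ha_pos hB hdisc
  obtain ⟨X, U, C, hCmono, hX0, hU0, hflow, hlip⟩ := exists_flow ha ha_pos hb hG hG0 0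
  have hXlim : ∀ s t, 0 ≤ t → Tendsto (fun s' => X s' t) (𝓝 s) (𝓝 (X s t)) := fun s t ht => by
    rw [tendsto_iff_dist_tendsto_zero]
    refine squeeze_zero (fun _ => dist_nonneg) (fun s' => (hlip s' s t ht).1) ?_
    have : Tendsto (fun s' : ℝ => C t * |s' - s|) (𝓝 s) (𝓝 (C t * |s - s|)) :=
      ((tendsto_id.sub_const s).abs).const_mul _
    simpa using this
  have hUlim : ∀ s t, 0 ≤ t → Tendsto (fun s' => U s' t) (𝓝 s) (𝓝 (U s t)) := fun s t ht => by
    rw [tendsto_iff_dist_tendsto_zero]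
    refine squeeze_zero (fun _ => dist_nonneg) (fun s' => (hlip s' s t ht).2) ?_
    have : Tendsto (fun s' : ℝ => C t * |s' - s|) (𝓝 s) (𝓝 (C t * |s - s|)) :=
      ((tendsto_id.sub_const s).abs).const_mul _
    simpa using this
  have hXc : ∀ s, ContinuousOn (X s) (Ici 0) := fun s t ht =>
    (hflow s t ht).1.continuousAt.continuousWithinAt
  set S : Set ℝ := {s | ∃ t, 1 ≤ t ∧ X s t < 0} with hS
  have hSopen : IsOpen S := by
    rw [isOpen_iff_mem_nhds]
    rintro s ⟨t, ht, hneg⟩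
    filter_upwards [(hXlim s t (zero_le_one.trans ht)).eventually (gt_mem_nhds hneg)] with s' hs'
    exact ⟨t, ht, hs'⟩
  have hstay : ∀ s τ, 1 ≤ τ → 0 < X s τ → 0 ≤ U s τ * y τ - X s τ * η τ → ∀ t, τ ≤ t → 0 < X s t :=
    fun s τ hτ hpos hW t ht => (hflow s).pos_of_wronskian_nonneg ha_pos hG_nonneg hG_le hB.le hbB
      zero_le_one hypos hy hτ hpos hW ht
  obtain ⟨s₁, hs₁, hr⟩ := hrise
  obtain ⟨s₂, hs₂, hc⟩ := hcross
  have hs₁S : s₁ ∉ S := by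
    rintro ⟨t, ht, hneg⟩
    obtain ⟨h1, h2⟩ := hr _ _ (hflow s₁) (hX0 _) (hU0 _)
    refine absurd (hstay s₁ 1 le_rfl h1 ?_ t ht) (not_lt.2 hneg.le)
    rw [hy1, hη1]; linarith
  have hs₂S : s₂ ∈ S := ⟨1, le_rfl, hc _ _ (hflow s₂) (hX0 _) (hU0 _)⟩
  obtain ⟨s, hscl, hs0, hsS⟩ : ∃ s, s ∈ closure S ∧ 0 < s ∧ s ∉ S := by
    by_contra! hcon
    exact hs₁S (isPreconnected_Ioi.subset_of_closure_inter_subset (s := Ioi (0:ℝ)) hSopen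
      ⟨s₂, hs₂, hs₂S⟩ (fun r hr => hcon r hr.1 hr.2) hs₁)
  obtain ⟨σ, hσS, hσ⟩ := mem_closure_iff_seq_limit.1 hscl
  have hnn : ∀ t, 1 ≤ t → 0 ≤ X s t := fun t ht => by
    by_contra hcon
    exact hsS ⟨t, ht, not_le.1 hcon⟩
  have hu0 : 0 < U s 0 := by rwa [hU0]
  have hpos01 : ∀ t ∈ Ioo (0:ℝ) 1, 0 < X s t := fun t ht =>
    (hflow s).pos_of_endpoint_nonneg ha ha_pos hb0 hG_nonneg (hX0 s) hu0 (hnn 1 le_rfl) ht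
  have hpos : ∀ t, 0 < t → 0 < X s t := fun t ht => by
    rcases lt_or_ge t 1 with h1 | h1
    · exact hpos01 t ⟨ht, h1⟩
    · refine lt_of_le_of_ne (hnn t h1) fun h0 => ?_
      have hmin : IsLocalMin (X s) t := by
        filter_upwards [lt_mem_nhds ht] with r hr
        rw [← h0]
        rcases lt_or_ge r 1 with h2 | h2
        · exact (hpos01 r ⟨hr, h2⟩).le
        · exact hnn r h2
      have hd := hmin.hasDerivAt_eq_zero (hflow s t ht.le).1
      have hut : U s t = 0 := by simpa [(ha_pos t).ne'] using hd
      rcases (hflow s).ne_zero_of_ne_zero ha ha_pos hb hG_abs ht.le hu0.ne' with h | h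
      · exact h h0.symm
      · exact h hut
  have hevpos : ∀ t, 1 ≤ t → ∀ᶠ n in atTop, ∀ r ∈ Icc 1 t, 0 < X (σ n) r := fun t ht => by
    obtain ⟨r₀, hr₀, hmin⟩ := isCompact_Icc.exists_isMinOn (nonempty_Icc.2 ht)
      ((hXc s).mono (Icc_subset_Ici_self.trans (Ici_subset_Ici.2 zero_le_one)))
    have hδ := hpos r₀ (zero_lt_one.trans_le hr₀.1)
    have hlim : Tendsto (fun n => C t * |σ n - s|) atTop (𝓝 0) := by
      simpa using ((hσ.sub_const s).abs).const_mul (C t)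
    filter_upwards [hlim.eventually (gt_mem_nhds hδ)] with n hn r hr
    have h1 := (hlip (σ n) s r (zero_le_one.trans hr.1)).1
    have h2 := mul_le_mul_of_nonneg_right (hCmono hr.2) (abs_nonneg (σ n - s))
    have h3 := (abs_le.1 h1).1
    have h4 : X s r₀ ≤ X s r := hmin hr
    linarith
  have hWneg : ∀ n t, 1 ≤ t → (∀ r ∈ Icc 1 t, 0 < X (σ n) r) →
      U (σ n) t * y t - X (σ n) t * η t < 0 := fun n t ht hp => by
    by_contra hcon
    obtain ⟨T, hT, hneg⟩ := hσS n
    rcases le_total T t with h | h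
    · exact absurd (hp T ⟨hT, h⟩) (not_lt.2 hneg.le)
    · exact absurd (hstay (σ n) t ht (hp t ⟨ht, le_rfl⟩) (not_lt.1 hcon) T h)
        (not_lt.2 hneg.le)
  have hW : ∀ t, 1 ≤ t → U s t * y t - X s t * η t ≤ 0 := fun t ht => by
    have ht0 := zero_le_one.trans ht
    refine le_of_tendsto ((((hUlim s t ht0).comp hσ).mul_const (y t)).sub
      (((hXlim s t ht0).comp hσ).mul_const (η t))) ?_
    filter_upwards [hevpos t ht] with n hn
    exact (hWneg n t ht hn).le
  refine ⟨X s, U s, hflow s, hX0 s, hpos, fun t ht => ?_, ?_⟩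
  · have h1 := hW t ht.le
    have h2 := mul_neg_of_pos_of_neg (hpos t (zero_lt_one.trans ht)) (hηneg t ht)
    by_contra hcon
    have := mul_nonneg (not_lt.1 hcon) (hypos t ht.le).le
    linarith
  · refine not_integrableOn_of_limit_of_vanishing (xn := fun n => X (σ n))
      (un := fun n => U (σ n)) ha ha_pos hb hG.continuous
      hG_nonneg hG_le hB.le hbB hy1 hη1 hypos hy (fun t ht => hflow s t (zero_le_one.trans ht))
      (fun n t ht => hflow (σ n) t (zero_le_one.trans ht))
      (fun t ht => (hXlim s t (zero_le_one.trans ht)).comp hσ)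
      ((hUlim s 1 zero_le_one).comp hσ) (fun t ht => hpos t (zero_lt_one.trans_le ht)) hW ?_
    filter_upwards [hevpos 1 le_rfl] with n hn
    obtain ⟨q, hq, hneg⟩ := hσS n
    obtain ⟨T, hT, hxT, hposT⟩ := exists_first_zero hq
      ((hXc (σ n)).mono (Icc_subset_Ici_self.trans (Ici_subset_Ici.2 zero_le_one)))
      (hn 1 ⟨le_rfl, le_rfl⟩) hneg.le
    have hWT : ∀ t ∈ Ico 1 T, U (σ n) t * y t - X (σ n) t * η t ≤ 0 := fun t ht =>
      (hWneg n t ht.1 fun r hr => hposT r ⟨hr.1, hr.2.trans_lt ht.2⟩).le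
    refine ⟨T, hT.1.le, hxT, fun t ht => ?_, fun t ht => ?_⟩
    · rcases ht.2.eq_or_lt with h | h
      · rw [h, hxT]
      · exact (hposT t ⟨ht.1, h⟩).le
    · have hcont : ContinuousOn (fun t => U (σ n) t * y t - X (σ n) t * η t) (Icc 1 T) :=
        fun r hr => by
          have h0 := hflow (σ n) r (zero_le_one.trans hr.1)
          exact ((h0.2.continuousAt.mul (hy r hr.1).1.continuousAt).sub
            (h0.1.continuousAt.mul (hy r hr.1).2.continuousAt)).continuousWithinAt
      have hcl : closure (Ico 1 T) = Icc 1 T := closure_Ico hT.1.ne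
      exact le_on_closure (s := Ico 1 T) hWT (by rwa [hcl]) continuousOn_const (by rwa [hcl])

/-- Positivity and the rise condition for a slope below the spectral threshold. -/
lemma exists_rising_slope {a b F G : ℝ → ℝ} (ha : Continuous a) (ha_pos : ∀ t, 0 < a t)
    (hb : Continuous b) (hb0 : ∀ t ∈ Icc (0:ℝ) 1, 0 ≤ b t) (hG_nonneg : ∀ r, 0 ≤ G r)
    (hG_mono : Monotone G) (hGF : ∀ r, 0 ≤ r → G r = F r) {l : Filter ℝ} [l.NeBot] {κ : ℝ}
    (hl : ∀ᶠ r in l, 0 < r) (hκ : Tendsto (fun r => F r / r) l (𝓝 κ))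
    (h : κ * (∫ s in (0:ℝ)..1, 1 / a s) * (∫ t in (0:ℝ)..1, b t) < 1) :
    ∃ s, 0 < s ∧ ∀ x u, IsFlow a b G 0 x u → x 0 = 0 → u 0 = s → 0 < x 1 ∧ 0 ≤ u 1 := by
  have hγ : 0 < ∫ s in (0:ℝ)..1, 1 / a s := by
    simpa using integral_one_div_strictMono ha ha_pos zero_lt_one
  obtain ⟨r, hr0, hr⟩ := (hl.and (((hκ.mul_const _).mul_const _).eventually (gt_mem_nhds h))).exists
  set γ := ∫ s in (0:ℝ)..1, 1 / a s with hγdef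
  refine ⟨r / γ, div_pos hr0 hγ, fun x u hx hx0 hu => ?_⟩
  refine hx.rising_at_one ha ha_pos hb hb0 hG_nonneg hG_mono hx0 (hu ▸ div_pos hr0 hγ) ?_
  rw [hu, ← hγdef, div_mul_cancel₀ _ hγ.ne', hGF r hr0.le, lt_div_iff₀ hγ]
  rw [div_mul_eq_mul_div, div_mul_eq_mul_div, div_lt_one hr0] at hr
  linarith

lemma exists_crossing_slope_nhds_zero {a b F G : ℝ → ℝ} (ha : Continuous a) (ha_pos : ∀ t, 0 < a t)
    (hb : Continuous b) (hb0 : ∀ t ∈ Icc (0:ℝ) 1, 0 ≤ b t) (hG_nonneg : ∀ r, 0 ≤ G r)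
    (hGF : ∀ r, 0 ≤ r → G r = F r) {t₁ t₂ κ : ℝ} (ht₁ : t₁ ∈ Ioo (0:ℝ) 1)
    (ht₂ : t₂ ∈ Ioo (0:ℝ) 1) (ht₁₂ : t₁ < t₂) (hκ : 0 ≤ κ)
    (hF : ∀ᶠ r in 𝓝[>] (0:ℝ), κ * r ≤ F r)
    (h : (∫ s in (0:ℝ)..1, 1 / a s) / ((∫ s in (0:ℝ)..t₁, 1 / a s) *
          ((∫ s in (0:ℝ)..1, 1 / a s) - ∫ s in (0:ℝ)..t₂, 1 / a s)) < κ * ∫ t in t₁..t₂, b t) :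
    ∃ s, 0 < s ∧ ∀ x u, IsFlow a b G 0 x u → x 0 = 0 → u 0 = s → x 1 < 0 := by
  have hγ : 0 < ∫ s in (0:ℝ)..1, 1 / a s := by
    simpa using integral_one_div_strictMono ha ha_pos zero_lt_one
  obtain ⟨δ, hδ, hFδ⟩ := mem_nhdsGT_iff_exists_Ioc_subset.1 hF
  have hs : 0 < δ / ∫ s in (0:ℝ)..1, 1 / a s := div_pos hδ hγ
  refine ⟨_, hs, fun x u hx hx0 hu => ?_⟩
  by_contra hcon
  have hu0 : 0 < u 0 := hu ▸ hs
  refine absurd (hx.forcing_le ha ha_pos hb hb0 hG_nonneg hx0 hu0 (not_lt.1 hcon) ht₁ ht₂ ht₁₂ hκ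
    fun t ht => ?_) (not_le.2 h)
  have ht' : t ∈ Ioo (0:ℝ) 1 := ⟨ht₁.1.trans_le ht.1, ht.2.trans_lt ht₂.2⟩
  have h1 := hx.pos_of_endpoint_nonneg ha ha_pos hb0 hG_nonneg hx0 hu0 (not_lt.1 hcon) ht'
  have h2 := hx.le_of_mem_Icc ha ha_pos hb0 hG_nonneg hx0 hu0 (Ioo_subset_Icc_self ht')
  rw [hu, div_mul_cancel₀ _ hγ.ne'] at h2
  rw [hGF _ h1.le]
  exact hFδ ⟨h1, h2⟩

lemma exists_crossing_slope_atTop {a b F G : ℝ → ℝ} (ha : Continuous a) (ha_pos : ∀ t, 0 < a t)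
    (hb : Continuous b) (hb0 : ∀ t ∈ Icc (0:ℝ) 1, 0 ≤ b t) (hG_nonneg : ∀ r, 0 ≤ G r)
    (hG_le : ∀ r, 0 ≤ r → G r ≤ r)
    (hGF : ∀ r, 0 ≤ r → G r = F r) {t₁ t₂ κ : ℝ} (ht₁ : t₁ ∈ Ioo (0:ℝ) 1)
    (ht₂ : t₂ ∈ Ioo (0:ℝ) 1) (ht₁₂ : t₁ < t₂) (hκ : 0 ≤ κ)
    (hF : ∀ᶠ r in atTop, κ * r ≤ F r)
    (h : (∫ s in (0:ℝ)..1, 1 / a s) / ((∫ s in (0:ℝ)..t₁, 1 / a s) *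
          ((∫ s in (0:ℝ)..1, 1 / a s) - ∫ s in (0:ℝ)..t₂, 1 / a s)) < κ * ∫ t in t₁..t₂, b t) :
    ∃ s, 0 < s ∧ ∀ x u, IsFlow a b G 0 x u → x 0 = 0 → u 0 = s → x 1 < 0 := by
  obtain ⟨R, hR⟩ := eventually_atTop.1 (hF.and (eventually_gt_atTop 0))
  have hR0 : 0 < R := (hR R le_rfl).2
  obtain ⟨c, hc, hcx⟩ := exists_slope_le ha ha_pos hb hb0 hG_nonneg hG_le ht₁ ht₂ ht₁₂
  refine ⟨c * R, mul_pos hc hR0, fun x u hx hx0 hu => ?_⟩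
  by_contra hcon
  have hu0 : 0 < u 0 := hu ▸ mul_pos hc hR0
  refine absurd (hx.forcing_le ha ha_pos hb hb0 hG_nonneg hx0 hu0 (not_lt.1 hcon) ht₁ ht₂ ht₁₂ hκ
    fun t ht => ?_) (not_le.2 h)
  have h1 := hcx x u hx hx0 hu0 (not_lt.1 hcon) t ht
  rw [hu] at h1
  have h2 := le_of_mul_le_mul_left h1 hc
  rw [hGF _ (hR0.le.trans h2)]
  exact (hR _ h2).1

/-- A function with derivative in `[0, 1]` on `[0, ∞)` is monotone and `1`-Lipschitz after being
frozen on the negative half-line. -/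
lemma sub_mem_Icc_of_hasDerivWithinAt {F F' : ℝ → ℝ}
    (hF_deriv : ∀ u ∈ Ici (0:ℝ), HasDerivWithinAt F (F' u) (Ici 0) u)
    (hF'_bd : ∀ u ∈ Ici (0:ℝ), 0 ≤ F' u ∧ F' u ≤ 1) {p q : ℝ} (hp : 0 ≤ p) (hpq : p ≤ q) :
    F p ≤ F q ∧ F q - F p ≤ q - p := by
  have hc : ContinuousOn F (Ici 0) := fun t ht => (hF_deriv t ht).continuousWithinAt
  have hd : ∀ t, 0 < t → HasDerivAt F (F' t) t := fun t ht =>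
    (hF_deriv t ht.le).hasDerivAt (Ici_mem_nhds ht)
  have h1 : MonotoneOn F (Ici 0) := by
    refine monotoneOn_of_deriv_nonneg (convex_Ici 0) hc (fun t ht => ?_) fun t ht => ?_ <;>
      rw [interior_Ici] at ht
    · exact (hd t ht).differentiableAt.differentiableWithinAt
    · rw [(hd t ht).deriv]; exact (hF'_bd t (mem_Ici.2 (le_of_lt ht))).1
  have h2 : MonotoneOn (fun t => t - F t) (Ici 0) := by
    refine monotoneOn_of_deriv_nonneg (convex_Ici 0) (continuousOn_id.sub hc)
      (fun t ht => ?_) fun t ht => ?_ <;> rw [interior_Ici] at ht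
    · exact ((hasDerivAt_id t).sub (hd t ht)).differentiableAt.differentiableWithinAt
    · have h := ((hasDerivAt_id' t).fun_sub (hd t ht)).deriv
      rw [h]
      linarith [(hF'_bd t (mem_Ici.2 (le_of_lt ht))).2]
  refine ⟨h1 hp (hp.trans hpq) hpq, ?_⟩
  have := h2 hp (hp.trans hpq) hpq
  simp only at this
  linarith

/-- Theorem 1 (main result): under the standing assumptions, disconjugacy of the dual
equation `v'' + (B/a)v = 0` on `[1,∞)` and the integral conditions (A1), (A2),
the BVP `(a x')' + b F(x) = 0`, `x(0)=0`, `x>0` on `(0,∞)`, `x(∞)=0` has a solution,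
which moreover has a local maximum in `(0,1]`, is decreasing on `[1,∞)` and satisfies
`∫₁^∞ dt/(a x²) = ∞`. -/
theorem dirichlet_halfline_main
    (a b F : ℝ → ℝ) (B k₀ kinf : ℝ)
    (ha_cont : ContinuousOn a (Ici 0)) (ha_pos : ∀ t ∈ Ici (0:ℝ), 0 < a t)
    (ha_int : IntegrableOn (fun t => 1 / a t) (Ici 0))
    (hb_cont : ContinuousOn b (Ici 0))
    (hb_nonneg : ∀ t ∈ Icc (0:ℝ) 1, 0 ≤ b t)
    (hb_ne : ∃ t ∈ Icc (0:ℝ) 1, b t ≠ 0)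
    (hB : 0 < B) (hbB : ∀ t ∈ Ici (1:ℝ), b t ≤ B)
    (hF_cont : Continuous F) (hF_sign : ∀ u : ℝ, u ≠ 0 → 0 < F u * u)
    (F' : ℝ → ℝ) (hF_deriv : ∀ u ∈ Ici (0:ℝ), HasDerivWithinAt F (F' u) (Ici 0) u)
    (hF'_bd : ∀ u ∈ Ici (0:ℝ), 0 ≤ F' u ∧ F' u ≤ 1)
    (hk₀ : Tendsto (fun u => F u / u) (𝓝[>] (0:ℝ)) (𝓝 k₀))
    (hkinf : Tendsto (fun u => F u / u) atTop (𝓝 kinf))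
    (hk₀_nonneg : 0 ≤ k₀) (hk_ne : k₀ ≠ kinf)
    (hdisc : Disconjugate2 (fun t => B / a t) (Ici 1))
    (t₁ t₂ : ℝ) (ht₁ : t₁ ∈ Ioo (0:ℝ) 1) (ht₂ : t₂ ∈ Ioo (0:ℝ) 1) (ht₁₂ : t₁ < t₂)
    (hb_int_pos : 0 < ∫ t in t₁..t₂, b t)
    (hA1 : min k₀ kinf * (∫ s in (0:ℝ)..1, 1 / a s) * (∫ t in (0:ℝ)..1, |b t|) < 1)
    (hA2 : max k₀ kinf * (∫ t in t₁..t₂, b t) >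
      (∫ s in (0:ℝ)..1, 1 / a s) /
        ((∫ s in (0:ℝ)..t₁, 1 / a s) *
          ((∫ s in (0:ℝ)..1, 1 / a s) - ∫ s in (0:ℝ)..t₂, 1 / a s))) :
    ∃ x x' : ℝ → ℝ, SolODE a b F (Ici 0) x x' ∧
      x 0 = 0 ∧ (∀ t, 0 < t → 0 < x t) ∧ Tendsto x atTop (𝓝 0) ∧
      (∃ t₀ ∈ Ioc (0:ℝ) 1, IsLocalMaxOn x (Ici 0) t₀) ∧
      StrictAntiOn x (Ici 1) ∧
      ¬ IntegrableOn (fun t => 1 / (a t * x t ^ 2)) (Ici 1) := by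
  set α : ℝ → ℝ := fun t => a (max t 0) with hα
  set β : ℝ → ℝ := fun t => b (max t 0) with hβ
  set G : ℝ → ℝ := fun r => F (max r 0) with hGdef
  have hαa : ∀ t, 0 ≤ t → α t = a t := fun t ht => by simp only [hα, max_eq_left ht]
  have hβb : ∀ t, 0 ≤ t → β t = b t := fun t ht => by simp only [hβ, max_eq_left ht]
  have hGF : ∀ r, 0 ≤ r → G r = F r := fun r hr => by simp only [hGdef, max_eq_left hr]
  have hmax : Continuous fun t : ℝ => max t 0 := continuous_id.max continuous_const
  have hαc : Continuous α := ha_cont.comp_continuous hmax fun t => mem_Ici.2 (le_max_right t 0)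
  have hβc : Continuous β := hb_cont.comp_continuous hmax fun t => mem_Ici.2 (le_max_right t 0)
  have hαpos : ∀ t, 0 < α t := fun t => ha_pos _ (mem_Ici.2 (le_max_right t 0))
  have hβ0 : ∀ t ∈ Icc (0:ℝ) 1, 0 ≤ β t := fun t ht => by
    rw [hβb t ht.1]; exact hb_nonneg t ht
  have hF0 : F 0 = 0 := by
    have hlim : Tendsto F (𝓝[>] 0) (𝓝 (F 0)) := hF_cont.continuousAt.continuousWithinAt
    have h1 : Tendsto F (𝓝[>] 0) (𝓝 (k₀ * 0)) := by
      refine (hk₀.mul (tendsto_nhdsWithin_of_tendsto_nhds tendsto_id)).congr' ?_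
      filter_upwards [self_mem_nhdsWithin] with r hr
      exact div_mul_cancel₀ _ (ne_of_gt hr)
    rw [mul_zero] at h1
    exact tendsto_nhds_unique hlim h1
  have hFinc := fun {p q : ℝ} => sub_mem_Icc_of_hasDerivWithinAt (p := p) (q := q) hF_deriv hF'_bd
  have hG0 : G 0 = 0 := by rw [hGF 0 le_rfl, hF0]
  have hG_mono : Monotone G := fun p q hpq =>
    (hFinc (le_max_right p 0) (max_le_max_right 0 hpq)).1
  have hG_nonneg : ∀ r, 0 ≤ G r := fun r => by
    have := (hFinc le_rfl (le_max_right r 0)).1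
    rwa [hF0] at this
  have hG_sub : ∀ p q, p ≤ q → G q - G p ≤ q - p := fun p q hpq => by
    refine (hFinc (le_max_right p 0) (max_le_max_right 0 hpq)).2.trans ?_
    rcases le_total p 0 with hp | hp <;> rcases le_total q 0 with hq | hq <;>
      simp only [max_eq_left, max_eq_right, hp, hq] <;> linarith
  have hG : LipschitzWith 1 G := LipschitzWith.of_dist_le_mul fun p q => by
    rw [NNReal.coe_one, one_mul, Real.dist_eq, Real.dist_eq]
    rcases le_total p q with h | h
    · rw [abs_sub_comm, abs_sub_comm p q, abs_of_nonneg (sub_nonneg.2 (hG_mono h)),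
        abs_of_nonneg (sub_nonneg.2 h)]
      exact hG_sub p q h
    · rw [abs_of_nonneg (sub_nonneg.2 (hG_mono h)), abs_of_nonneg (sub_nonneg.2 h)]
      exact hG_sub q p h
  have hG_le : ∀ r, 0 ≤ r → G r ≤ r := fun r hr => by
    have := hG_sub 0 r hr
    rw [hG0] at this
    linarith
  have hdisc' : Disconjugate2 (fun t => B / α t) (Ici 1) := by
    rintro v v' v'' ⟨h1, h2, h3, h4⟩
    exact hdisc v v' v'' ⟨h1, h2, h3, fun t ht => by
      have := h4 t ht
      simp only [hαa t (zero_le_one.trans ht)] at this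
      exact this⟩
  have hint_xα : ∀ t, 0 ≤ t → ∫ s in (0:ℝ)..t, 1 / a s = ∫ s in (0:ℝ)..t, 1 / α s := fun t ht =>
    intervalIntegral.integral_congr fun s hs => by
      rw [uIcc_of_le ht] at hs
      simp only [hαa s hs.1]
  have hint_xβ : ∫ t in (0:ℝ)..1, |b t| = ∫ t in (0:ℝ)..1, β t :=
    intervalIntegral.integral_congr fun s hs => by
      rw [uIcc_of_le zero_le_one] at hs
      simp only [hβb s hs.1, abs_of_nonneg (hb_nonneg s hs)]
  have hint_xβ' : ∫ t in t₁..t₂, b t = ∫ t in t₁..t₂, β t :=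
    intervalIntegral.integral_congr fun s hs => by
      rw [uIcc_of_le ht₁₂.le] at hs
      simp only [hβb s (ht₁.1.le.trans hs.1)]
  rw [hint_xα 1 zero_le_one, hint_xβ] at hA1
  rw [hint_xα 1 zero_le_one, hint_xα t₁ ht₁.1.le, hint_xα t₂ ht₂.1.le, hint_xβ', gt_iff_lt] at hA2
  rw [hint_xβ'] at hb_int_pos
  have hαm := integral_one_div_strictMono hαc hαpos
  have hΓ : 0 < (∫ s in (0:ℝ)..1, 1 / α s) / ((∫ s in (0:ℝ)..t₁, 1 / α s) *
      ((∫ s in (0:ℝ)..1, 1 / α s) - ∫ s in (0:ℝ)..t₂, 1 / α s)) := by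
    have h1 := hαm ht₁.1
    have h2 := hαm ht₂.2
    have h3 := hαm (zero_lt_one (α := ℝ))
    simp only [intervalIntegral.integral_same] at h1 h2 h3
    exact div_pos h3 (mul_pos h1 (sub_pos.2 h2))
  rw [← div_lt_iff₀ hb_int_pos] at hA2
  obtain ⟨κ, hκ1, hκ2⟩ := exists_between hA2
  have hκ0 : 0 ≤ κ := (div_pos hΓ hb_int_pos).le.trans hκ1.le
  rw [div_lt_iff₀ hb_int_pos] at hκ1
  have hκF : ∀ {l : Filter ℝ} {k : ℝ}, (∀ᶠ r in l, 0 < r) → Tendsto (fun r => F r / r) l (𝓝 k) →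
      κ < k → ∀ᶠ r in l, κ * r ≤ F r := fun hl hk hlt => by
    filter_upwards [hl, hk.eventually (lt_mem_nhds hlt)] with r hr0 hr
    exact ((lt_div_iff₀ hr0).1 hr).le
  have hl0 : ∀ᶠ r in 𝓝[>] (0:ℝ), 0 < r := self_mem_nhdsWithin
  have hltop : ∀ᶠ r in atTop, (0:ℝ) < r := eventually_gt_atTop 0
  obtain ⟨hrise, hcross⟩ :
      (∃ s, 0 < s ∧ ∀ x u, IsFlow α β G 0 x u → x 0 = 0 → u 0 = s → 0 < x 1 ∧ 0 ≤ u 1) ∧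
      (∃ s, 0 < s ∧ ∀ x u, IsFlow α β G 0 x u → x 0 = 0 → u 0 = s → x 1 < 0) := by
    rcases hk_ne.lt_or_gt with h | h
    · rw [min_eq_left h.le] at hA1
      rw [max_eq_right h.le] at hκ2
      exact ⟨exists_rising_slope hαc hαpos hβc hβ0 hG_nonneg hG_mono hGF hl0 hk₀ hA1,
        exists_crossing_slope_atTop hαc hαpos hβc hβ0 hG_nonneg hG_le hGF ht₁ ht₂ ht₁₂ hκ0
          (hκF hltop hkinf hκ2) hκ1⟩
    · rw [min_eq_right h.le] at hA1
      rw [max_eq_left h.le] at hκ2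
      exact ⟨exists_rising_slope hαc hαpos hβc hβ0 hG_nonneg hG_mono hGF hltop hkinf hA1,
        exists_crossing_slope_nhds_zero hαc hαpos hβc hβ0 hG_nonneg hGF ht₁ ht₂ ht₁₂ hκ0
          (hκF hl0 hk₀ hκ2) hκ1⟩
  obtain ⟨x, u, hx, hx0, hxpos, huneg, hnint⟩ := exists_principal_flow hαc hαpos hβc hβ0 hG
    hG_nonneg hG0 hB (fun t ht => by rw [hβb t (zero_le_one.trans ht)]; exact hbB t ht) hdisc'
    hrise hcross
  have hxnn : ∀ t, 0 ≤ t → 0 ≤ x t := fun t ht => by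
    rcases ht.eq_or_lt with h | h
    · rw [← h, hx0]
    · exact (hxpos t h).le
  have hxc : ContinuousOn x (Ici 0) := fun t ht => (hx t ht).1.continuousAt.continuousWithinAt
  have huc : ContinuousOn u (Ici 0) := fun t ht => (hx t ht).2.continuousAt.continuousWithinAt
  have hanti : StrictAntiOn x (Ici 1) := fun p hp q hq hpq => by
    have h := lt_of_hasDerivAt_pos hpq
      (fun r hr => (hx r (zero_le_one.trans (le_trans hp hr.1))).1.neg) (fun r hr => by
        rw [← neg_div]
        exact div_pos (neg_pos.2 (huneg r (lt_of_le_of_lt hp hr.1))) (hαpos r))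
    simpa using h
  have hnint' : ¬ IntegrableOn (fun t => 1 / (a t * x t ^ 2)) (Ici 1) := fun h =>
    hnint (h.congr_fun (fun t ht => by
      simp only [hαa t (zero_le_one.trans ht)]) measurableSet_Ici)
  refine ⟨x, fun t => u t / α t, ⟨fun t ht => (hx t ht).1.hasDerivWithinAt,
    huc.div hαc.continuousOn fun t _ => (hαpos t).ne', fun t => -(β t * G (x t)), ?_, ?_, ?_⟩,
    hx0, hxpos, ?_, ?_, hanti, hnint'⟩
  · have e : ∀ t ∈ Ici (0:ℝ), a t * (u t / α t) = u t := fun t ht => by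
      rw [← hαa t ht, mul_div_cancel₀ _ (hαpos t).ne']
    exact fun t ht => (hx t ht).2.hasDerivWithinAt.congr e (e t ht)
  · exact (hβc.continuousOn.mul (hG.continuous.comp_continuousOn hxc)).neg
  · intro t ht
    simp only [hβb t ht, hGF _ (hxnn t ht)]
    ring
  · have hbdd : BddBelow (range fun t => x (max t 1)) :=
      ⟨0, by rintro _ ⟨t, rfl⟩; exact hxnn _ (zero_le_one.trans (le_max_right _ _))⟩
    have hant : Antitone fun t => x (max t 1) := fun p q hpq =>
      hanti.antitoneOn (le_max_right p 1) (le_max_right q 1) (max_le_max_right 1 hpq)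
    have hlim := tendsto_atTop_ciInf hant hbdd
    set L := ⨅ t, x (max t 1)
    have hLle : ∀ t, 1 ≤ t → L ≤ x t := fun t ht => by
      have := ciInf_le hbdd t
      rwa [max_eq_left ht] at this
    have hL0 : 0 ≤ L := le_ciInf fun t => hxnn _ (zero_le_one.trans (le_max_right _ _))
    have hL0' : L = 0 := by
      by_contra hne
      refine hnint' (Integrable.mono'
        ((ha_int.mono_set (Ici_subset_Ici.2 zero_le_one)).mul_const (1 / L ^ 2)) ?_ ?_)
      · refine ContinuousOn.aestronglyMeasurable ?_ measurableSet_Ici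
        have hsub : Ici (1:ℝ) ⊆ Ici 0 := Ici_subset_Ici.2 zero_le_one
        exact continuousOn_const.div ((ha_cont.mono hsub).mul ((hxc.mono hsub).pow 2)) fun t ht =>
          (mul_pos (ha_pos t (hsub ht)) (pow_pos (hxpos t (zero_lt_one.trans_le ht)) 2)).ne'
      · filter_upwards [ae_restrict_mem measurableSet_Ici] with t ht
        have ha1 := ha_pos t (mem_Ici.2 (zero_le_one.trans ht))
        rw [Real.norm_eq_abs, abs_of_nonneg (by positivity), ← one_div_mul_one_div]
        exact mul_le_mul_of_nonneg_left (one_div_le_one_div_of_le (by positivity)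
          (pow_le_pow_left₀ hL0 (hLle t ht) 2)) (by positivity)
    rw [hL0'] at hlim
    refine hlim.congr' ?_
    filter_upwards [eventually_ge_atTop 1] with t ht
    rw [max_eq_left ht]
  · obtain ⟨t₀, ht₀, hmax⟩ := isCompact_Icc.exists_isMaxOn (nonempty_Icc.2 zero_le_one)
      (hxc.mono (Icc_subset_Ici_self : Icc (0:ℝ) 1 ⊆ Ici 0))
    have h1 : x 1 ≤ x t₀ := hmax (right_mem_Icc.2 zero_le_one)
    have ht₀pos : 0 < t₀ := by
      refine lt_of_le_of_ne ht₀.1 fun h => ?_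
      rw [← h, hx0] at h1
      exact absurd (hxpos 1 zero_lt_one) (not_lt.2 h1)
    refine ⟨t₀, ⟨ht₀pos, ht₀.2⟩, IsMaxOn.localize fun t ht => ?_⟩
    rcases le_total t 1 with h | h
    · exact hmax ⟨ht, h⟩
    · exact (hanti.antitoneOn self_mem_Ici h h).trans h1
end

section
/- Let g : [0,1] → ℝ be continuous and nonnegative and let F satisfy the standing nonlinearity assumptions. If there exist t₁, t₂ ∈ (0,1) with t₁ < t₂ such that ∫_{t₁}^{t₂} g(t) dt > 0, min{k₀, k_∞}·|g|_L < 1, and max{k₀, k_∞}·∫_{t₁}^{t₂} g(t) dt > 1/(t₁(1 − t₂)), then the equation z'' + g(t)F(z) = 0 has a solution z₁ ∈ Δ₁ and a solution z₂ ∈ Δ₂. -/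
open Set Filter MeasureTheory Topology Real

/-- `z`, with derivative `w`, solves `z'' + g G(z) = 0` on `[0, 1]` with `z(0) = 0`, `z'(0) = c`. -/
structure IsShot (g G : ℝ → ℝ) (c : ℝ) (z w : ℝ → ℝ) : Prop where
  deriv_z : ∀ t ∈ Icc (0:ℝ) 1, HasDerivWithinAt z (w t) (Icc 0 1) t
  deriv_w : ∀ t ∈ Icc (0:ℝ) 1, HasDerivWithinAt w (-(g t * G (z t))) (Icc 0 1) t
  z_zero : z 0 = 0
  w_zero : w 0 = c

lemma mul_sub_le_sub_of_le_hasDerivWithinAt {f f' : ℝ → ℝ} {p q a b m : ℝ}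
    (hf : ∀ t ∈ Icc p q, HasDerivWithinAt f (f' t) (Icc p q) t)
    (ha : p ≤ a) (hab : a ≤ b) (hb : b ≤ q) (hm : ∀ t ∈ Icc a b, m ≤ f' t) :
    m * (b - a) ≤ f b - f a := by
  have hsub : Icc a b ⊆ Icc p q := Icc_subset_Icc ha hb
  have hd : ∀ t ∈ interior (Icc a b), HasDerivAt f (f' t) t := by
    intro t ht
    rw [interior_Icc] at ht
    exact (hf t (hsub (Ioo_subset_Icc_self ht))).hasDerivAt
      (Icc_mem_nhds (ha.trans_lt ht.1) (ht.2.trans_le hb))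
  refine (convex_Icc a b).mul_sub_le_image_sub_of_le_deriv
    (fun t ht => ((hf t (hsub ht)).continuousWithinAt).mono hsub)
    (fun t ht => (hd t ht).differentiableAt.differentiableWithinAt)
    (fun t ht => ?_) a (left_mem_Icc.2 hab) b (right_mem_Icc.2 hab) hab
  rw [(hd t ht).deriv]
  exact hm t (interior_subset ht)

lemma sub_le_mul_sub_of_hasDerivWithinAt_le {f f' : ℝ → ℝ} {p q a b m : ℝ}
    (hf : ∀ t ∈ Icc p q, HasDerivWithinAt f (f' t) (Icc p q) t)
    (ha : p ≤ a) (hab : a ≤ b) (hb : b ≤ q) (hm : ∀ t ∈ Icc a b, f' t ≤ m) :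
    f b - f a ≤ m * (b - a) := by
  have := mul_sub_le_sub_of_le_hasDerivWithinAt (f := fun t => -f t) (f' := fun t => -f' t)
    (m := -m) (fun t ht => (hf t ht).neg) ha hab hb (fun t ht => neg_le_neg (hm t ht))
  linarith

namespace IsShot

variable {g G z w : ℝ → ℝ} {c a b : ℝ}

lemma antitone (h : IsShot g G c z w) (hg : ∀ t ∈ Icc (0:ℝ) 1, 0 ≤ g t) (hG : ∀ u, 0 ≤ G u)
    (ha : 0 ≤ a) (hab : a ≤ b) (hb : b ≤ 1) : w b ≤ w a := by
  have := sub_le_mul_sub_of_hasDerivWithinAt_le (m := 0) h.deriv_w ha hab hb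
    (fun t ht => neg_nonpos.2 (mul_nonneg (hg t ⟨ha.trans ht.1, ht.2.trans hb⟩) (hG _)))
  linarith

lemma le_chord (h : IsShot g G c z w) (hg : ∀ t ∈ Icc (0:ℝ) 1, 0 ≤ g t) (hG : ∀ u, 0 ≤ G u)
    (ha : 0 ≤ a) (hab : a ≤ b) (hb : b ≤ 1) : w b * (b - a) ≤ z b - z a :=
  mul_sub_le_sub_of_le_hasDerivWithinAt h.deriv_z ha hab hb
    (fun _ ht => h.antitone hg hG (ha.trans ht.1) ht.2 hb)

lemma chord_le (h : IsShot g G c z w) (hg : ∀ t ∈ Icc (0:ℝ) 1, 0 ≤ g t) (hG : ∀ u, 0 ≤ G u)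
    (ha : 0 ≤ a) (hab : a ≤ b) (hb : b ≤ 1) : z b - z a ≤ w a * (b - a) :=
  sub_le_mul_sub_of_hasDerivWithinAt_le h.deriv_z ha hab hb
    (fun _ ht => h.antitone hg hG ha ht.1 (ht.2.trans hb))

lemma le_mul (h : IsShot g G c z w) (hg : ∀ t ∈ Icc (0:ℝ) 1, 0 ≤ g t) (hG : ∀ u, 0 ≤ G u)
    (ha : 0 ≤ a) (ha1 : a ≤ 1) : z a ≤ c * a := by
  have := h.chord_le hg hG le_rfl ha ha1
  rwa [h.z_zero, h.w_zero, sub_zero, sub_zero] at this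

lemma le_slope (h : IsShot g G c z w) (hg : ∀ t ∈ Icc (0:ℝ) 1, 0 ≤ g t) (hG : ∀ u, 0 ≤ G u)
    (hc : 0 ≤ c) (ha : 0 ≤ a) (ha1 : a ≤ 1) : z a ≤ c :=
  (h.le_mul hg hG ha ha1).trans (mul_le_of_le_one_right hc ha1)

lemma hasDerivWithinAt_Ioi {f f' : ℝ → ℝ}
    (hf : ∀ t ∈ Icc (0:ℝ) 1, HasDerivWithinAt f (f' t) (Icc 0 1) t)
    (ha : 0 ≤ a) (hb : b ≤ 1) : ∀ t ∈ Ioo a b, HasDerivWithinAt f (f' t) (Ioi t) t := fun t ht =>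
  ((hf t ⟨ha.trans ht.1.le, ht.2.le.trans hb⟩).hasDerivAt
    (Icc_mem_nhds (ha.trans_lt ht.1) (ht.2.trans_le hb))).hasDerivWithinAt

lemma sub_le_integral (h : IsShot g G c z w) (hgc : ContinuousOn g (Icc 0 1))
    (hg : ∀ t ∈ Icc (0:ℝ) 1, 0 ≤ g t) (ha : 0 ≤ a) (hab : a ≤ b) (hb : b ≤ 1)
    {B : ℝ} (hB : ∀ t ∈ Icc a b, G (z t) ≤ B) : w a - w b ≤ B * ∫ t in a..b, g t := by
  have hsub : Icc a b ⊆ Icc 0 1 := Icc_subset_Icc ha hb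
  have := intervalIntegral.integral_le_sub_of_hasDeriv_right_of_le (φ := fun t => -B * g t) hab
    (fun t ht => ((h.deriv_w t (hsub ht)).continuousWithinAt).mono hsub)
    (hasDerivWithinAt_Ioi h.deriv_w ha hb)
    ((continuousOn_const.mul (hgc.mono hsub)).integrableOn_Icc)
    (fun t ht => by
      have h1 := hg t (hsub (Ioo_subset_Icc_self ht))
      have h2 := hB t (Ioo_subset_Icc_self ht)
      nlinarith)
  rw [intervalIntegral.integral_const_mul] at this
  linarith

lemma integral_le_sub (h : IsShot g G c z w) (hgc : ContinuousOn g (Icc 0 1))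
    (hg : ∀ t ∈ Icc (0:ℝ) 1, 0 ≤ g t) (ha : 0 ≤ a) (hab : a ≤ b) (hb : b ≤ 1)
    {B : ℝ} (hB : ∀ t ∈ Icc a b, B ≤ G (z t)) : B * (∫ t in a..b, g t) ≤ w a - w b := by
  have hsub : Icc a b ⊆ Icc 0 1 := Icc_subset_Icc ha hb
  have := intervalIntegral.sub_le_integral_of_hasDeriv_right_of_le (φ := fun t => -B * g t) hab
    (fun t ht => ((h.deriv_w t (hsub ht)).continuousWithinAt).mono hsub)
    (hasDerivWithinAt_Ioi h.deriv_w ha hb)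
    ((continuousOn_const.mul (hgc.mono hsub)).integrableOn_Icc)
    (fun t ht => by
      have h1 := hg t (hsub (Ioo_subset_Icc_self ht))
      have h2 := hB t (Ioo_subset_Icc_self ht)
      nlinarith)
  rw [intervalIntegral.integral_const_mul] at this
  linarith

/-- A uniform lower bound for shots that stay nonnegative up to time `1`. -/
lemma exists_mul_le (g G : ℝ → ℝ) (hgc : ContinuousOn g (Icc 0 1))
    (hg : ∀ t ∈ Icc (0:ℝ) 1, 0 ≤ g t) (hG : ∀ u, 0 ≤ G u) (hGm : Monotone G)
    (hGle : ∀ u, 0 ≤ u → G u ≤ u) :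
    ∃ κ > 0, ∀ c > 0, ∀ z w, IsShot g G c z w → 0 ≤ z 1 →
      ∀ t ∈ Icc (0:ℝ) 1, t * (1 - t) * (κ * c) ≤ z t := by
  obtain ⟨M, hM⟩ := isCompact_Icc.exists_bound_of_continuousOn hgc
  have hM0 : 0 ≤ M := (norm_nonneg _).trans (hM 0 (by simp))
  obtain ⟨r, hr⟩ : ∃ r : ℝ, r = 1 / (2 * (M + 1)) := ⟨_, rfl⟩
  have hr0 : 0 < r := by rw [hr]; positivity
  have hrM : 2 * (M + 1) * r = 1 := by rw [hr]; field_simp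
  have hr1 : r ≤ 1 := by nlinarith
  refine ⟨r / 2, by positivity, fun c hc z w h h1 t ht => ?_⟩
  have hwr : c / 2 ≤ w r := by
    have := mul_sub_le_sub_of_le_hasDerivWithinAt (m := -(M * c)) h.deriv_w le_rfl hr0.le hr1
      (fun s hs => by
        have hs' : s ∈ Icc (0:ℝ) 1 := ⟨hs.1, hs.2.trans hr1⟩
        have h2 : G (z s) ≤ c := (hGm (h.le_slope hg hG hc.le hs'.1 hs'.2)).trans (hGle c hc.le)
        have h3 : g s ≤ M := (le_abs_self _).trans (hM s hs')
        exact neg_le_neg (mul_le_mul h3 h2 (hG _) hM0))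
    rw [h.w_zero] at this
    nlinarith
  have hzr : r / 2 * c ≤ z r := by
    have := h.le_chord hg hG le_rfl hr0.le hr1
    rw [h.z_zero] at this
    nlinarith
  have hpos : 0 < r / 2 * c := by positivity
  obtain ⟨ht0, ht1⟩ := ht
  rcases le_total t r with htr | htr
  · have e1 := h.le_chord hg hG le_rfl ht0 ht1
    have e2 := h.chord_le hg hG ht0 htr hr1
    rw [h.z_zero] at e1
    have e3 : t * z r ≤ r * z t := by nlinarith
    have e5 : t * (r / 2 * c) ≤ r * z t :=
      (mul_le_mul_of_nonneg_left hzr ht0).trans e3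
    have hzt : 0 ≤ z t := nonneg_of_mul_nonneg_right ((mul_nonneg ht0 hpos.le).trans e5) hr0
    nlinarith [mul_nonneg ht0 hpos.le, mul_nonneg (mul_nonneg ht0 ht0) hpos.le]
  · have e1 := h.chord_le hg hG ht0 ht1 le_rfl
    have e2 := h.le_chord hg hG hr0.le htr ht1
    have e3 : (1 - t) * z r ≤ (1 - r) * z t := by nlinarith
    have e5 : (1 - t) * (r / 2 * c) ≤ (1 - r) * z t :=
      (mul_le_mul_of_nonneg_left hzr (by linarith)).trans e3
    have hzt : 0 ≤ z t := by
      by_contra! hneg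
      have h6 : (1 - r) * z t ≤ 0 := mul_nonpos_of_nonneg_of_nonpos (by linarith) hneg.le
      have h7 : 1 - t ≤ 0 := by by_contra! h8; nlinarith [mul_pos h8 hpos]
      have h8 : t = 1 := by linarith
      rw [h8] at hneg
      linarith
    nlinarith [mul_nonneg (sub_nonneg.2 ht1) hpos.le,
      mul_nonneg (mul_nonneg (sub_nonneg.2 ht1) (sub_nonneg.2 ht1)) hpos.le]

/-- A shot which is nonnegative at time `1` satisfies a reverse growth bound at its minimum over
`[t₁, t₂]`. -/
lemma mul_integral_le_min (h : IsShot g G c z w) (hgc : ContinuousOn g (Icc 0 1))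
    (hg : ∀ t ∈ Icc (0:ℝ) 1, 0 ≤ g t) (hG : ∀ u, 0 ≤ G u) (hGm : Monotone G) (h1 : 0 ≤ z 1)
    {t₁ t₂ : ℝ} (ht₁ : 0 < t₁) (ht₁₂ : t₁ ≤ t₂) (ht₂ : t₂ < 1) :
    t₁ * (1 - t₂) * (G (min (z t₁) (z t₂)) * ∫ t in t₁..t₂, g t) ≤ min (z t₁) (z t₂) := by
  have hmin : ∀ s ∈ Icc t₁ t₂, min (z t₁) (z t₂) ≤ z s := by
    intro s hs
    have e1 := h.le_chord hg hG ht₁.le hs.1 (hs.2.trans ht₂.le)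
    have e2 := h.chord_le hg hG (ht₁.le.trans hs.1) hs.2 ht₂.le
    rcases le_total 0 (w s) with hw | hw
    · exact min_le_of_left_le (by nlinarith [hs.1])
    · exact min_le_of_right_le (by nlinarith [hs.2])
  have hI := h.integral_le_sub hgc hg ht₁.le ht₁₂ ht₂.le (fun s hs => hGm (hmin s hs))
  set A := G (min (z t₁) (z t₂)) * ∫ t in t₁..t₂, g t
  have e1 := h.le_chord hg hG le_rfl ht₁.le (ht₁₂.trans ht₂.le)
  have e2 := h.chord_le hg hG ht₁.le ht₁₂ ht₂.le
  have e3 := h.le_chord hg hG ht₁.le ht₁₂ ht₂.le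
  have e4 := h.chord_le hg hG (ht₁.le.trans ht₁₂) ht₂.le le_rfl
  rw [h.z_zero] at e1
  have hs : 0 < 1 - t₂ := by linarith
  rcases le_total (z t₁) (z t₂) with hm | hm
  · rw [min_eq_left hm]
    have e5 : (1 - t₂) * A ≤ (1 - t₁) * w t₁ + z t₁ := by nlinarith
    nlinarith
  · rw [min_eq_right hm]
    have e5 : t₁ * A ≤ z t₂ - t₂ * w t₂ := by nlinarith
    nlinarith

end IsShot

lemma exists_isShot_family (g G : ℝ → ℝ) (hgc : ContinuousOn g (Icc 0 1))
    (hg : ∀ t ∈ Icc (0:ℝ) 1, 0 ≤ g t) (hG : ∀ u, 0 ≤ G u) (hGm : Monotone G)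
    (hGL : LipschitzWith 1 G) (hGle : ∀ u, 0 ≤ u → G u ≤ u) {C : ℝ} (hC : 0 ≤ C) :
    ∃ Z W : ℝ → ℝ → ℝ, (∀ c ∈ Icc 0 C, IsShot g G c (Z c) (W c)) ∧
      ContinuousOn (fun c => Z c 1) (Icc 0 C) ∧ ContinuousOn (fun c => W c 1) (Icc 0 C) := by
  obtain ⟨M, hM⟩ := isCompact_Icc.exists_bound_of_continuousOn hgc
  have hM0 : 0 ≤ M := (norm_nonneg _).trans (hM 0 (by simp))
  lift M to NNReal using hM0
  lift C to NNReal using hC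
  let B : NNReal := C + M * C
  let f : ℝ → ℝ × ℝ → ℝ × ℝ := fun t p => (max (-B : ℝ) (min p.2 B), -(g t * G (min p.1 C)))
  have hGC : ∀ u, G (min u C) ≤ C := fun u => (hGm (min_le_right _ _)).trans (hGle _ C.2)
  have hpl : IsPicardLindelof f (tmin := 0) (tmax := 1) ⟨0, by simp⟩ ((0:ℝ), (C / 2 : ℝ))
      (B + M * C + C / 2) (C / 2) (B + M * C) (max 1 M) := by
    refine ⟨fun t ht => LipschitzWith.lipschitzOnWith ?_, fun x _ => ?_, fun t ht x _ => ?_, ?_⟩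
    · refine LipschitzWith.prodMk ?_ ?_
      · have := ((LipschitzWith.prod_snd (α := ℝ) (β := ℝ)).min_const (B:ℝ)).const_max (-B : ℝ)
        exact this
      · refine LipschitzWith.of_dist_le_mul fun p q => ?_
        have h1 : |G (min p.1 C) - G (min q.1 C)| ≤ dist p q := by
          have := (hGL.comp ((LipschitzWith.prod_fst (α := ℝ) (β := ℝ)).min_const (C:ℝ))).dist_le_mul
            p q
          simpa [Real.dist_eq] using this
        have h2 := hM t ht
        rw [Real.dist_eq, show -(g t * G (min p.1 C)) - -(g t * G (min q.1 C))
          = -(g t * (G (min p.1 C) - G (min q.1 C))) by ring, abs_neg, abs_mul]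
        exact mul_le_mul h2 h1 (abs_nonneg _) M.2
    · exact continuousOn_const.prodMk (hgc.mul continuousOn_const).neg
    · rw [Prod.norm_def]
      refine max_le ?_ ?_
      · have : |max (-B : ℝ) (min x.2 B)| ≤ B :=
          abs_le.2 ⟨le_max_left _ _, max_le (by linarith [B.2]) (min_le_right _ _)⟩
        refine this.trans ?_
        exact_mod_cast le_self_add
      · have : |-(g t * G (min x.1 C))| ≤ M * C := by
          rw [abs_neg, abs_mul, abs_of_nonneg (hG _)]
          exact mul_le_mul (hM t ht) (hGC _) (hG _) M.2
        refine this.trans ?_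
        push_cast
        linarith [B.2]
    · simp
  obtain ⟨α, hα, hαc⟩ := hpl.exists_forall_mem_closedBall_eq_hasDerivWithinAt_continuousOn
  have hmem : ∀ c ∈ Icc (0:ℝ) C,
      ((0:ℝ), c) ∈ Metric.closedBall ((0:ℝ), (C / 2 : ℝ)) (C / 2 : NNReal) := by
    intro c hc
    rw [Metric.mem_closedBall, Prod.dist_eq, dist_self, Real.dist_eq]
    refine max_le (by positivity) ?_
    push_cast
    exact abs_le.2 ⟨by linarith [hc.1], by linarith [hc.2]⟩
  have hcont : ContinuousOn (fun c : ℝ => α (((0:ℝ), c), 1)) (Icc 0 C) :=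
    hαc.comp (by fun_prop) (fun c hc => ⟨hmem c hc, by simp⟩)
  refine ⟨fun c t => (α ((0, c), t)).1, fun c t => (α ((0, c), t)).2, fun c hc => ?_,
    hcont.fst, hcont.snd⟩
  obtain ⟨h0, hd⟩ := hα _ (hmem c hc)
  have hd1 : ∀ t ∈ Icc (0:ℝ) 1, HasDerivWithinAt (fun t => (α ((0, c), t)).1)
      (max (-B : ℝ) (min (α ((0, c), t)).2 B)) (Icc 0 1) t := fun t ht =>
    (ContinuousLinearMap.fst ℝ ℝ ℝ).hasFDerivAt.comp_hasDerivWithinAt t (hd t ht)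
  have hd2 : ∀ t ∈ Icc (0:ℝ) 1, HasDerivWithinAt (fun t => (α ((0, c), t)).2)
      (-(g t * G (min (α ((0, c), t)).1 C))) (Icc 0 1) t := fun t ht =>
    (ContinuousLinearMap.snd ℝ ℝ ℝ).hasFDerivAt.comp_hasDerivWithinAt t (hd t ht)
  have hz0 : (α ((0, c), 0)).1 = 0 := congrArg Prod.fst h0
  have hw0 : (α ((0, c), 0)).2 = c := congrArg Prod.snd h0
  have hwle : ∀ t ∈ Icc (0:ℝ) 1, (α ((0, c), t)).2 ≤ c := by
    intro t ht
    have := sub_le_mul_sub_of_hasDerivWithinAt_le (m := 0) hd2 le_rfl ht.1 ht.2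
      (fun s hs => neg_nonpos.2 (mul_nonneg (hg s ⟨hs.1, hs.2.trans ht.2⟩) (hG _)))
    linarith
  have hwge : ∀ t ∈ Icc (0:ℝ) 1, -(B:ℝ) ≤ (α ((0, c), t)).2 := by
    intro t ht
    have := mul_sub_le_sub_of_le_hasDerivWithinAt (m := -(M * C : ℝ)) hd2 le_rfl ht.1 ht.2
      (fun s hs => neg_le_neg (mul_le_mul
        ((le_abs_self _).trans (hM s ⟨hs.1, hs.2.trans ht.2⟩)) (hGC _) (hG _) M.2))
    have hMC : (0:ℝ) ≤ M * C := by positivity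
    have hB : (B : ℝ) = C + M * C := by simp [B]
    rw [hB]
    nlinarith [ht.2, ht.1, hc.1, C.2]
  have hCB : (C : ℝ) ≤ B := by
    have hMC : (0:ℝ) ≤ M * C := by positivity
    simpa [B] using hMC
  have hclamp : ∀ t ∈ Icc (0:ℝ) 1,
      max (-B : ℝ) (min (α ((0, c), t)).2 B) = (α ((0, c), t)).2 := fun t ht => by
    rw [min_eq_left ((hwle t ht).trans (hc.2.trans hCB)), max_eq_right (hwge t ht)]
  have hzle : ∀ t ∈ Icc (0:ℝ) 1, (α ((0, c), t)).1 ≤ C := by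
    intro t ht
    have := sub_le_mul_sub_of_hasDerivWithinAt_le (m := c) hd1 le_rfl ht.1 ht.2
      (fun s hs => by
        have hs' : s ∈ Icc (0:ℝ) 1 := ⟨hs.1, hs.2.trans ht.2⟩
        rw [hclamp s hs']
        exact hwle s hs')
    nlinarith [ht.1, ht.2, hc.1, hc.2]
  refine ⟨fun t ht => ?_, fun t ht => ?_, hz0, hw0⟩
  · have := hd1 t ht
    rwa [hclamp t ht] at this
  · have := hd2 t ht
    rwa [min_eq_left (hzle t ht)] at this

/-- Lemma 1: if `g ≥ 0` is continuous on `[0,1]`, `∫_{t₁}^{t₂} g > 0`,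
`min{k₀,k∞}·|g|_L < 1` and `max{k₀,k∞}·∫_{t₁}^{t₂} g > 1/(t₁(1-t₂))`, then
`z'' + g F(z) = 0` has a solution in `Δ₁` and a solution in `Δ₂`. -/
theorem exists_Delta1_Delta2_for_second_order
    (g : ℝ → ℝ) (hg_cont : ContinuousOn g (Icc 0 1)) (hg_nonneg : ∀ t ∈ Icc (0:ℝ) 1, 0 ≤ g t)
    (F : ℝ → ℝ) (k₀ kinf : ℝ)
    (hF_cont : Continuous F) (hF_sign : ∀ u : ℝ, u ≠ 0 → 0 < F u * u)
    (F' : ℝ → ℝ) (hF_deriv : ∀ u ∈ Ici (0:ℝ), HasDerivWithinAt F (F' u) (Ici 0) u)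
    (hF'_bd : ∀ u ∈ Ici (0:ℝ), 0 ≤ F' u ∧ F' u ≤ 1)
    (hk₀ : Tendsto (fun u => F u / u) (𝓝[>] (0:ℝ)) (𝓝 k₀))
    (hkinf : Tendsto (fun u => F u / u) atTop (𝓝 kinf))
    (hk₀_nonneg : 0 ≤ k₀) (hk_ne : k₀ ≠ kinf)
    (t₁ t₂ : ℝ) (ht₁ : t₁ ∈ Ioo (0:ℝ) 1) (ht₂ : t₂ ∈ Ioo (0:ℝ) 1) (ht₁₂ : t₁ < t₂)
    (hg_int_pos : 0 < ∫ t in t₁..t₂, g t)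
    (hcond1 : min k₀ kinf * (∫ t in (0:ℝ)..1, |g t|) < 1)
    (hcond2 : max k₀ kinf * (∫ t in t₁..t₂, g t) > 1 / (t₁ * (1 - t₂))) :
    (∃ z₁ z₁' z₁'' : ℝ → ℝ, SolODE2 g F (Icc 0 1) z₁ z₁' z₁'' ∧
      z₁ 0 = 0 ∧ z₁ 1 = 0 ∧ ∀ t ∈ Ioo (0:ℝ) 1, 0 < z₁ t) ∧
    (∃ z₂ z₂' z₂'' : ℝ → ℝ, SolODE2 g F (Icc 0 1) z₂ z₂' z₂'' ∧
      z₂ 0 = 0 ∧ z₂' 1 = 0 ∧ ∀ t ∈ Ioc (0:ℝ) 1, 0 < z₂ t) := by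
  have hF0 : F 0 = 0 := by
    refine le_antisymm ?_ ?_
    · refine le_of_tendsto (hF_cont.continuousWithinAt (s := Iio 0) (x := 0)) ?_
      filter_upwards [self_mem_nhdsWithin] with u hu
      exact (neg_of_mul_pos_left (hF_sign u hu.ne) hu.le).le
    · refine ge_of_tendsto (hF_cont.continuousWithinAt (s := Ioi 0) (x := 0)) ?_
      filter_upwards [self_mem_nhdsWithin] with u hu
      exact (pos_of_mul_pos_left (hF_sign u hu.ne') (le_of_lt hu)).le
  have hFmono : MonotoneOn F (Ici 0) :=
    monotoneOn_of_hasDerivWithinAt_nonneg (convex_Ici 0) hF_cont.continuousOn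
      (fun u hu => (hF_deriv u (interior_subset hu)).mono interior_subset)
      (fun u hu => (hF'_bd u (interior_subset hu)).1)
  have hFlip : LipschitzOnWith 1 F (Ici 0) :=
    (convex_Ici (0:ℝ)).lipschitzOnWith_of_nnnorm_hasDerivWithin_le hF_deriv (fun u hu => by
      have := hF'_bd u hu
      rw [← NNReal.coe_le_coe, coe_nnnorm, Real.norm_eq_abs, abs_of_nonneg this.1]
      exact this.2)
  obtain ⟨G, hGdef⟩ : ∃ G : ℝ → ℝ, ∀ u, G u = F (max u 0) := ⟨_, fun _ => rfl⟩
  have hGF : ∀ u, 0 ≤ u → G u = F u := fun u hu => by rw [hGdef, max_eq_left hu]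
  have hGm : Monotone G := fun u v huv => by
    rw [hGdef, hGdef]
    exact hFmono (mem_Ici.2 (le_max_right u 0)) (mem_Ici.2 (le_max_right v 0))
      (max_le_max_right 0 huv)
  have hG : ∀ u, 0 ≤ G u := fun u => by
    have := hFmono self_mem_Ici (mem_Ici.2 (le_max_right u 0)) (le_max_right u 0)
    rwa [hF0, ← hGdef] at this
  have hGL : LipschitzWith 1 G := by
    refine LipschitzWith.of_dist_le_mul fun u v => ?_
    rw [hGdef, hGdef]
    refine (hFlip.dist_le_mul _ (le_max_right u 0) _ (le_max_right v 0)).trans ?_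
    gcongr
    simpa [Real.dist_eq] using abs_max_sub_max_le_abs u v 0
  have hGle : ∀ u, 0 ≤ u → G u ≤ u := fun u hu => by
    have := hGL.dist_le_mul u 0
    rw [Real.dist_eq, Real.dist_eq, hGF 0 le_rfl, hF0, sub_zero, sub_zero, abs_of_nonneg hu,
      abs_of_nonneg (hG u)] at this
    simpa using this
  have hJ : ∫ t in (0:ℝ)..1, |g t| = ∫ t in (0:ℝ)..1, g t :=
    intervalIntegral.integral_congr fun t ht =>
      abs_of_nonneg (hg_nonneg t (by rwa [uIcc_of_le zero_le_one] at ht))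
  rw [hJ] at hcond1
  obtain ⟨κ, hκ, hκle⟩ := IsShot.exists_mul_le g G hg_cont hg_nonneg hG hGm hGle
  obtain ⟨ρ, hρ, hρle⟩ : ∃ ρ > 0, ∀ c > 0, ∀ z w, IsShot g G c z w → 0 ≤ z 1 →
      ∃ m, 0 < m ∧ m ≤ c ∧ ρ * c ≤ m ∧
        F m / m * (∫ t in t₁..t₂, g t) ≤ 1 / (t₁ * (1 - t₂)) := by
    have hp₁ : 0 < t₁ * (1 - t₁) := mul_pos ht₁.1 (sub_pos.2 ht₁.2)
    have hp₂ : 0 < t₂ * (1 - t₂) := mul_pos ht₂.1 (sub_pos.2 ht₂.2)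
    have hp : 0 < t₁ * (1 - t₂) := mul_pos ht₁.1 (sub_pos.2 ht₂.2)
    have hρ : 0 < min (t₁ * (1 - t₁)) (t₂ * (1 - t₂)) * κ := mul_pos (lt_min hp₁ hp₂) hκ
    refine ⟨_, hρ, fun c hc z w h h1 => ?_⟩
    have hm : min (t₁ * (1 - t₁)) (t₂ * (1 - t₂)) * κ * c ≤ min (z t₁) (z t₂) := by
      have hκc : 0 ≤ κ * c := by positivity
      rw [mul_assoc]
      exact le_min
        ((mul_le_mul_of_nonneg_right (min_le_left _ _) hκc).trans
          (hκle c hc z w h h1 t₁ (Ioo_subset_Icc_self ht₁)))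
        ((mul_le_mul_of_nonneg_right (min_le_right _ _) hκc).trans
          (hκle c hc z w h h1 t₂ (Ioo_subset_Icc_self ht₂)))
    have hm0 : 0 < min (z t₁) (z t₂) := (mul_pos hρ hc).trans_le hm
    refine ⟨min (z t₁) (z t₂), hm0,
      (min_le_left _ _).trans (h.le_slope hg_nonneg hG hc.le ht₁.1.le ht₁.2.le), hm, ?_⟩
    have := h.mul_integral_le_min hg_cont hg_nonneg hG hGm h1 ht₁.1 ht₁₂.le ht₂.2
    rw [hGF _ hm0.le] at this
    rw [div_mul_eq_mul_div, div_le_div_iff₀ hm0 hp]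
    linarith
  obtain ⟨⟨c₀, hc₀, hFc₀⟩, c₁, hc₁, hneg⟩ :
      (∃ c > 0, F c / c * (∫ t in (0:ℝ)..1, g t) < 1) ∧
      ∃ c > 0, ∀ z w, IsShot g G c z w → z 1 < 0 := by
    have hpos₀ : ∀ᶠ u in 𝓝[>] (0:ℝ), 0 < u := self_mem_nhdsWithin
    rcases lt_or_gt_of_ne hk_ne with hk | hk
    · rw [min_eq_left hk.le] at hcond1
      rw [max_eq_right hk.le] at hcond2
      refine ⟨(hpos₀.and ((hk₀.mul_const _).eventually_lt_const hcond1)).exists, ?_⟩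
      obtain ⟨R, hR⟩ := eventually_atTop.1 ((hkinf.mul_const _).eventually_const_lt hcond2)
      refine ⟨max R 1 / ρ, by positivity, fun z w h => ?_⟩
      by_contra! h1
      obtain ⟨m, hm, -, hρm, hFm⟩ := hρle _ (by positivity) z w h h1
      rw [mul_div_cancel₀ _ hρ.ne'] at hρm
      exact hFm.not_gt (hR m ((le_max_left _ _).trans hρm))
    · rw [min_eq_right hk.le] at hcond1
      rw [max_eq_left hk.le] at hcond2
      refine ⟨((eventually_gt_atTop 0).and
        ((hkinf.mul_const _).eventually_lt_const hcond1)).exists, ?_⟩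
      obtain ⟨δ, hδ, hδF⟩ :=
        mem_nhdsGT_iff_exists_Ioc_subset.1 ((hk₀.mul_const _).eventually_const_lt hcond2)
      refine ⟨δ, hδ, fun z w h => ?_⟩
      by_contra! h1
      obtain ⟨m, hm, hmc, -, hFm⟩ := hρle _ hδ z w h h1
      exact hFm.not_gt (hδF ⟨hm, hmc⟩)
  obtain ⟨Z, W, hZW, hZ, hW⟩ := exists_isShot_family g G hg_cont hg_nonneg hG hGm hGL hGle
    (hc₀.le.trans (le_max_left c₀ c₁))
  have hsub : uIcc c₀ c₁ ⊆ Icc 0 (max c₀ c₁) := Icc_subset_Icc_left (le_min hc₀.le hc₁.le)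
  have hmono : ∀ c ∈ Icc 0 (max c₀ c₁), W c 1 ≤ Z c 1 := fun c hc => by
    have := (hZW c hc).le_chord hg_nonneg hG le_rfl zero_le_one le_rfl
    rwa [(hZW c hc).z_zero, sub_zero, sub_zero, mul_one] at this
  have hmem₀ := hsub left_mem_uIcc
  have hmem₁ := hsub right_mem_uIcc
  have hW₀ : 0 < W c₀ 1 := by
    have := (hZW c₀ hmem₀).sub_le_integral hg_cont hg_nonneg le_rfl zero_le_one le_rfl
      (fun t ht => hGm ((hZW c₀ hmem₀).le_slope hg_nonneg hG hc₀.le ht.1 ht.2))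
    rw [(hZW c₀ hmem₀).w_zero, hGF _ hc₀.le] at this
    rw [div_mul_eq_mul_div, div_lt_one hc₀] at hFc₀
    linarith
  have hZ₀ : 0 < Z c₀ 1 := hW₀.trans_le (hmono c₀ hmem₀)
  have hZ₁ : Z c₁ 1 < 0 := hneg _ _ (hZW c₁ hmem₁)
  have hW₁ : W c₁ 1 < 0 := (hmono c₁ hmem₁).trans_lt hZ₁
  have hpos : ∀ c ∈ uIcc c₀ c₁, 0 ≤ Z c 1 → ∀ t ∈ Ioo (0:ℝ) 1, 0 < Z c t := fun c hc h1 t ht => by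
    have hc0 : 0 < c := (lt_min hc₀ hc₁).trans_le hc.1
    refine lt_of_lt_of_le ?_ (hκle c hc0 _ _ (hZW c (hsub hc)) h1 t (Ioo_subset_Icc_self ht))
    exact mul_pos (mul_pos ht.1 (sub_pos.2 ht.2)) (mul_pos hκ hc0)
  have hsol : ∀ c ∈ uIcc c₀ c₁, 0 ≤ Z c 1 →
      SolODE2 g F (Icc 0 1) (Z c) (W c) (fun t => -(g t * F (Z c t))) := fun c hc h1 => by
    have h := hZW c (hsub hc)
    refine ⟨h.deriv_z, fun t ht => ?_, ?_, fun t _ => neg_add_cancel _⟩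
    · have hnn : 0 ≤ Z c t := by
        rcases ht.1.eq_or_lt with rfl | h0
        · exact h.z_zero.ge
        rcases ht.2.eq_or_lt with rfl | h2
        · exact h1
        exact (hpos c hc h1 t ⟨h0, h2⟩).le
      have := h.deriv_w t ht
      rwa [hGF _ hnn] at this
    · exact (hg_cont.mul (hF_cont.comp_continuousOn
        fun t ht => (h.deriv_z t ht).continuousWithinAt)).neg
  constructor
  · obtain ⟨c, hc, hc0⟩ := intermediate_value_uIcc (hZ.mono hsub)
      (mem_uIcc_of_ge hZ₁.le hZ₀.le)
    exact ⟨Z c, W c, _, hsol c hc hc0.ge, (hZW c (hsub hc)).z_zero, hc0, hpos c hc hc0.ge⟩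
  · obtain ⟨c, hc, hc0⟩ := intermediate_value_uIcc (hW.mono hsub)
      (mem_uIcc_of_ge hW₁.le hW₀.le)
    have hc0 : W c 1 = 0 := hc0
    have h := hZW c (hsub hc)
    have h1 : 0 ≤ Z c 1 := hc0.ge.trans (hmono c (hsub hc))
    refine ⟨Z c, W c, _, hsol c hc h1, h.z_zero, hc0, fun t ht => ?_⟩
    rcases ht.2.eq_or_lt with rfl | ht1
    · have e := h.le_chord hg_nonneg hG (a := 1 / 2) (by norm_num) (by norm_num) le_rfl
      rw [hc0, zero_mul] at e
      linarith [hpos c hc h1 (1 / 2) ⟨by norm_num, by norm_num⟩]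
    · exact hpos c hc h1 t ⟨ht.1, ht1⟩
end

section
/- Let g : [0,1] → ℝ be continuous with g(t) > 0 for all t ∈ [0,1] and let F satisfy the standing nonlinearity assumptions. If min{k₀, k_∞}·|g|_L < 1 and max{k₀, k_∞}·min_{t∈[0,1]} g(t) > 27, then the equation z'' + g(t)F(z) = 0 has a solution z₁ ∈ Δ₁ and a solution z₂ ∈ Δ₂. -/
open Set Filter MeasureTheory Topology Real

/-- `z` (with derivative `w`) solves `z'' + g Φ(z) = 0` on `[0,1]` with `z 0 = 0`, `z' 0 = s`. -/
structure IsShot_s2 (g Φ : ℝ → ℝ) (s : ℝ) (z w : ℝ → ℝ) : Prop where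
  left : z 0 = 0
  left_deriv : w 0 = s
  hasDeriv : ∀ t ∈ Icc (0 : ℝ) 1, HasDerivWithinAt z (w t) (Icc 0 1) t
  hasDeriv_deriv : ∀ t ∈ Icc (0 : ℝ) 1, HasDerivWithinAt w (-(g t * Φ (z t))) (Icc 0 1) t

/-- A nonnegative nonlinearity that vanishes on `(-∞, 0]` and is `1`-Lipschitz. -/
structure IsCutoff (Φ : ℝ → ℝ) : Prop where
  lipschitz : LipschitzWith 1 Φ
  nonneg : ∀ u, 0 ≤ Φ u
  eq_zero : ∀ u ≤ 0, Φ u = 0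

lemma IsCutoff.le_of_nonneg {Φ : ℝ → ℝ} (h : IsCutoff Φ) {u : ℝ} (hu : 0 ≤ u) : Φ u ≤ u := by
  have := h.lipschitz.dist_le_mul u 0
  simp only [NNReal.coe_one, one_mul, Real.dist_eq, sub_zero, h.eq_zero 0 le_rfl,
    abs_of_nonneg hu] at this
  exact (le_abs_self _).trans this

lemma IsCutoff.le_of_le {Φ : ℝ → ℝ} (h : IsCutoff Φ) {u M : ℝ} (hM : 0 ≤ M) (hu : u ≤ M) :
    Φ u ≤ M := by
  rcases le_total u 0 with h0 | h0
  · rw [h.eq_zero u h0]; exact hM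
  · exact (h.le_of_nonneg h0).trans hu

lemma apply_le_of_hasDerivAt_nonpos {f f' : ℝ → ℝ} {a b : ℝ} (hab : a ≤ b)
    (hf : ContinuousOn f (Icc a b)) (hd : ∀ x ∈ Ioo a b, HasDerivAt f (f' x) x)
    (h : ∀ x ∈ Ioo a b, f' x ≤ 0) : f b ≤ f a := by
  refine antitoneOn_of_hasDerivWithinAt_nonpos (f' := f') (convex_Icc a b) hf ?_ ?_
    (left_mem_Icc.2 hab) (right_mem_Icc.2 hab) hab
  · rw [interior_Icc]; exact fun x hx => (hd x hx).hasDerivWithinAt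
  · rw [interior_Icc]; exact h

namespace IsShot_s2

variable {g Φ : ℝ → ℝ} {s : ℝ} {z w : ℝ → ℝ}

lemma continuousOn (h : IsShot_s2 g Φ s z w) : ContinuousOn z (Icc 0 1) :=
  fun t ht => (h.hasDeriv t ht).continuousWithinAt

lemma continuousOn_deriv (h : IsShot_s2 g Φ s z w) : ContinuousOn w (Icc 0 1) :=
  fun t ht => (h.hasDeriv_deriv t ht).continuousWithinAt

lemma hasDerivAt (h : IsShot_s2 g Φ s z w) {t : ℝ} (ht : t ∈ Ioo (0 : ℝ) 1) :
    HasDerivAt z (w t) t :=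
  (h.hasDeriv t (Ioo_subset_Icc_self ht)).hasDerivAt (Icc_mem_nhds ht.1 ht.2)

lemma hasDerivAt_deriv (h : IsShot_s2 g Φ s z w) {t : ℝ} (ht : t ∈ Ioo (0 : ℝ) 1) :
    HasDerivAt w (-(g t * Φ (z t))) t :=
  (h.hasDeriv_deriv t (Ioo_subset_Icc_self ht)).hasDerivAt (Icc_mem_nhds ht.1 ht.2)

lemma deriv_anti (h : IsShot_s2 g Φ s z w) (hΦ : IsCutoff Φ) (hg : ∀ t ∈ Icc (0 : ℝ) 1, 0 < g t)
    {a b : ℝ} (ha : 0 ≤ a) (hab : a ≤ b) (hb : b ≤ 1) : w b ≤ w a :=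
  apply_le_of_hasDerivAt_nonpos hab (h.continuousOn_deriv.mono (Icc_subset_Icc ha hb))
    (fun _ hx => h.hasDerivAt_deriv (Ioo_subset_Ioo ha hb hx))
    (fun x hx => neg_nonpos.2 (mul_nonneg
      (hg x (Icc_subset_Icc ha hb (Ioo_subset_Icc_self hx))).le (hΦ.nonneg _)))

lemma le_add_mul (h : IsShot_s2 g Φ s z w) {a b c : ℝ} (ha : 0 ≤ a) (hab : a ≤ b) (hb : b ≤ 1)
    (hc : ∀ t ∈ Ioo a b, w t ≤ c) : z b ≤ z a + c * (b - a) := by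
  have := apply_le_of_hasDerivAt_nonpos (f := fun t => z t - c * t) (f' := fun t => w t - c * 1)
    hab ((h.continuousOn.mono (Icc_subset_Icc ha hb)).sub (by fun_prop))
    (fun x hx => (h.hasDerivAt (Ioo_subset_Ioo ha hb hx)).sub ((hasDerivAt_id x).const_mul c))
    (fun x hx => by linarith [hc x hx])
  linarith

lemma add_mul_le (h : IsShot_s2 g Φ s z w) {a b c : ℝ} (ha : 0 ≤ a) (hab : a ≤ b) (hb : b ≤ 1)
    (hc : ∀ t ∈ Ioo a b, c ≤ w t) : z a + c * (b - a) ≤ z b := by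
  have := apply_le_of_hasDerivAt_nonpos (f := fun t => c * t - z t) (f' := fun t => c * 1 - w t)
    hab (ContinuousOn.sub (by fun_prop) (h.continuousOn.mono (Icc_subset_Icc ha hb)))
    (fun x hx => ((hasDerivAt_id x).const_mul c).sub (h.hasDerivAt (Ioo_subset_Ioo ha hb hx)))
    (fun x hx => by linarith [hc x hx])
  linarith

/-- The graph of a shot lies below its tangents. -/
lemma le_tangent (h : IsShot_s2 g Φ s z w) (hΦ : IsCutoff Φ) (hg : ∀ t ∈ Icc (0 : ℝ) 1, 0 < g t)
    {a b : ℝ} (ha : a ∈ Icc (0 : ℝ) 1) (hb : b ∈ Icc (0 : ℝ) 1) :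
    z b ≤ z a + w a * (b - a) := by
  rcases le_total a b with hab | hab
  · exact h.le_add_mul ha.1 hab hb.2 fun t ht =>
      h.deriv_anti hΦ hg ha.1 ht.1.le (ht.2.le.trans hb.2)
  · have := h.add_mul_le (c := w a) hb.1 hab ha.2 fun t ht =>
      h.deriv_anti hΦ hg (hb.1.trans ht.1.le) ht.2.le ha.2
    linarith

lemma le_slope_mul (h : IsShot_s2 g Φ s z w) (hΦ : IsCutoff Φ) (hg : ∀ t ∈ Icc (0 : ℝ) 1, 0 < g t)
    {t : ℝ} (ht : t ∈ Icc (0 : ℝ) 1) : z t ≤ s * t := by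
  have := h.le_tangent hΦ hg (left_mem_Icc.2 zero_le_one) ht
  rw [h.left, h.left_deriv] at this
  linarith

lemma pos_of_deriv_nonneg (h : IsShot_s2 g Φ s z w) (hΦ : IsCutoff Φ)
    (hg : ∀ t ∈ Icc (0 : ℝ) 1, 0 < g t) (hs : 0 < s) {t : ℝ} (ht : t ∈ Ioc (0 : ℝ) 1)
    (hw : 0 ≤ w t) : 0 < z t := by
  by_contra! hz
  have ht' : t ∈ Icc (0 : ℝ) 1 := ⟨ht.1.le, ht.2⟩
  have h0 := h.le_tangent hΦ hg ht' (left_mem_Icc.2 zero_le_one)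
  rw [h.left] at h0
  have hw0 : w t = 0 := by
    refine le_antisymm ?_ hw
    by_contra! hpos
    nlinarith [mul_pos hpos ht.1]
  have hz' : ∀ r ∈ Icc (0 : ℝ) 1, z r ≤ 0 := fun r hr => by
    have := h.le_tangent hΦ hg ht' hr
    rw [hw0] at this
    linarith
  have := apply_le_of_hasDerivAt_nonpos (f := fun r => -w r) (f' := fun _ => 0) ht.1.le
    (h.continuousOn_deriv.mono (Icc_subset_Icc le_rfl ht.2)).neg
    (fun x hx => by
      have hx' := Ioo_subset_Ioo le_rfl ht.2 hx
      have := (h.hasDerivAt_deriv hx').neg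
      rwa [hΦ.eq_zero _ (hz' x (Ioo_subset_Icc_self hx')), mul_zero, neg_zero, neg_zero] at this)
    (fun _ _ => le_rfl)
  simp only [hw0, h.left_deriv] at this
  linarith

lemma pos_of_right_eq_zero (h : IsShot_s2 g Φ s z w) (hΦ : IsCutoff Φ)
    (hg : ∀ t ∈ Icc (0 : ℝ) 1, 0 < g t) (hs : 0 < s) (h1 : z 1 = 0) {t : ℝ}
    (ht : t ∈ Ioo (0 : ℝ) 1) : 0 < z t := by
  rcases le_or_gt 0 (w t) with hw | hw
  · exact h.pos_of_deriv_nonneg hΦ hg hs ⟨ht.1, ht.2.le⟩ hw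
  · have := h.le_tangent hΦ hg (Ioo_subset_Icc_self ht) (right_mem_Icc.2 zero_le_one)
    rw [h1] at this
    nlinarith [mul_pos (neg_pos.2 hw) (sub_pos.2 ht.2)]

lemma pos_of_right_deriv_eq_zero (h : IsShot_s2 g Φ s z w) (hΦ : IsCutoff Φ)
    (hg : ∀ t ∈ Icc (0 : ℝ) 1, 0 < g t) (hs : 0 < s) (h1 : w 1 = 0) {t : ℝ}
    (ht : t ∈ Ioc (0 : ℝ) 1) : 0 < z t :=
  h.pos_of_deriv_nonneg hΦ hg hs ht (h1 ▸ h.deriv_anti hΦ hg ht.1.le ht.2 le_rfl)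

lemma right_deriv_pos (h : IsShot_s2 g Φ s z w) (hΦ : IsCutoff Φ) (hgc : ContinuousOn g (Icc 0 1))
    (hg : ∀ t ∈ Icc (0 : ℝ) 1, 0 < g t) (hs : 0 < s) {c : ℝ}
    (hc : ∀ u ∈ Icc 0 s, Φ u ≤ c * s) (hc0 : 0 ≤ c) (hcI : c * ∫ t in (0 : ℝ)..1, |g t| < 1) :
    0 < w 1 := by
  have hcont : ContinuousOn (fun t => -(g t * Φ (z t))) (Icc 0 1) :=
    (hgc.mul (hΦ.lipschitz.continuous.comp_continuousOn h.continuousOn)).neg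
  have hint := hcont.intervalIntegrable_of_Icc (μ := volume) zero_le_one
  have hFTC := intervalIntegral.integral_eq_sub_of_hasDerivAt_of_le zero_le_one
    h.continuousOn_deriv (fun t ht => h.hasDerivAt_deriv ht) hint
  have hint2 : IntervalIntegrable (fun t => -(c * s * |g t|)) volume 0 1 :=
    (continuousOn_const.mul hgc.abs).neg.intervalIntegrable_of_Icc zero_le_one
  have hle : ∫ t in (0 : ℝ)..1, -(c * s * |g t|) ≤ ∫ t in (0 : ℝ)..1, -(g t * Φ (z t)) := by
    refine intervalIntegral.integral_mono_on zero_le_one hint2 hint fun t ht => neg_le_neg ?_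
    have hΦle : Φ (z t) ≤ c * s := by
      rcases le_total (z t) 0 with hz | hz
      · rw [hΦ.eq_zero _ hz]; positivity
      · exact hc _ ⟨hz, (h.le_slope_mul hΦ hg ht).trans (by nlinarith [ht.2])⟩
    rw [abs_of_pos (hg t ht), mul_comm (c * s)]
    exact mul_le_mul_of_nonneg_left hΦle (hg t ht).le
  rw [hFTC, h.left_deriv, intervalIntegral.integral_neg, intervalIntegral.integral_const_mul] at hle
  nlinarith

lemma mul_min_le (h : IsShot_s2 g Φ s z w) (hΦ : IsCutoff Φ) (hg : ∀ t ∈ Icc (0 : ℝ) 1, 0 < g t)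
    (h1 : 0 ≤ z 1) {p t : ℝ} (hp : p ∈ Icc (0 : ℝ) 1) (hzp : 0 ≤ z p)
    (ht : t ∈ Icc (0 : ℝ) 1) : z p * min t (1 - t) ≤ z t := by
  have e0 := h.le_tangent hΦ hg ht (left_mem_Icc.2 zero_le_one)
  have e1 := h.le_tangent hΦ hg ht (right_mem_Icc.2 zero_le_one)
  have ep := h.le_tangent hΦ hg ht hp
  rw [h.left] at e0
  obtain ⟨ht0, ht1⟩ := ht
  obtain ⟨hp0, hp1⟩ := hp
  have hz : 0 ≤ z t := by nlinarith
  rcases le_total t p with htp | htp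
  · have hmul : z p * t ≤ z t * p := by
      nlinarith [mul_le_mul_of_nonneg_left e0 (sub_nonneg.2 htp),
        mul_le_mul_of_nonneg_left ep ht0]
    nlinarith [mul_le_mul_of_nonneg_left (min_le_left t (1 - t)) hzp,
      mul_le_mul_of_nonneg_left hp1 hz]
  · have hmul : z p * (1 - t) ≤ z t * (1 - p) := by
      nlinarith [mul_le_mul_of_nonneg_left e1 (sub_nonneg.2 htp),
        mul_le_mul_of_nonneg_left ep (sub_nonneg.2 ht1)]
    nlinarith [mul_le_mul_of_nonneg_left (min_le_right t (1 - t)) hzp,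
      mul_nonneg hz hp0]

lemma slope_le (h : IsShot_s2 g Φ s z w) (hΦ : IsCutoff Φ) (hg : ∀ t ∈ Icc (0 : ℝ) 1, 0 < g t)
    {G M : ℝ} (hG : ∀ t ∈ Icc (0 : ℝ) 1, g t ≤ G) (hM0 : 0 ≤ M)
    (hM : ∀ t ∈ Icc (0 : ℝ) 1, z t ≤ M) : s ≤ M * (1 + G) := by
  have hGpos : 0 < G := (hg 0 (by simp)).trans_le (hG 0 (by simp))
  have hw : ∀ t ∈ Ioo (0 : ℝ) 1, s - G * M ≤ w t := fun t ht => by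
    have := apply_le_of_hasDerivAt_nonpos (f := fun r => -w r - G * M * r)
      (f' := fun r => - -(g r * Φ (z r)) - G * M * 1) ht.1.le
      ((h.continuousOn_deriv.mono (Icc_subset_Icc le_rfl ht.2.le)).neg.sub (by fun_prop))
      (fun x hx => (h.hasDerivAt_deriv (Ioo_subset_Ioo le_rfl ht.2.le hx)).neg.sub
        ((hasDerivAt_id x).const_mul (G * M)))
      (fun x hx => by
        have hx' := Ioo_subset_Icc_self (Ioo_subset_Ioo le_rfl ht.2.le hx)
        have := mul_le_mul (hG x hx') (hΦ.le_of_le hM0 (hM x hx')) (hΦ.nonneg _) hGpos.le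
        linarith)
    simp only [h.left_deriv] at this
    nlinarith [mul_nonneg hGpos.le hM0, ht.2]
  have := h.add_mul_le le_rfl zero_le_one le_rfl hw
  rw [h.left] at this
  linarith [hM 1 (by simp)]

lemma right_neg (h : IsShot_s2 g Φ s z w) (hΦ : IsCutoff Φ)
    (hg : ∀ t ∈ Icc (0 : ℝ) 1, 0 < g t) (hs : 0 < s) {G m k ε : ℝ}
    (hG : ∀ t ∈ Icc (0 : ℝ) 1, g t ≤ G) (hm0 : 0 < m) (hm : ∀ t ∈ Icc (0 : ℝ) 1, m ≤ g t)
    (hkm : 27 < k * m) (hε : m * ε * (1 + G) ≤ 1 / 2) (hε0 : 0 ≤ ε)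
    (hlow : ∀ u ∈ Icc 0 s, k * u - ε * s ≤ Φ u) : z 1 < 0 := by
  by_contra! h1
  obtain ⟨p, hp, hmax⟩ := isCompact_Icc.exists_isMaxOn (nonempty_Icc.2 (zero_le_one' ℝ))
    h.continuousOn
  have hM : ∀ t ∈ Icc (0 : ℝ) 1, z t ≤ z p := fun t ht => hmax ht
  have hM0 : 0 ≤ z p := h1.trans (hM 1 (by simp))
  have hsM := h.slope_le hΦ hg hG hM0 hM
  have hGpos : 0 < G := (hg 0 (by simp)).trans_le (hG 0 (by simp))
  have hMpos : 0 < z p := by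
    by_contra! hle
    nlinarith
  set M := z p with hMdef
  have hforce : ∀ t ∈ Icc (0 : ℝ) 1, 27 * M * min t (1 - t) - M / 2 ≤ g t * Φ (z t) := by
    intro t ht
    have hmin := h.mul_min_le hΦ hg h1 hp hM0 ht
    have hmin0 : 0 ≤ min t (1 - t) := le_min ht.1 (sub_nonneg.2 ht.2)
    have hz0 : 0 ≤ z t := (mul_nonneg hM0 hmin0).trans hmin
    have hl := hlow (z t) ⟨hz0, (h.le_slope_mul hΦ hg ht).trans (by nlinarith [ht.2])⟩
    have hml := mul_le_mul_of_nonneg_left hl hm0.le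
    have hms : m * (ε * s) ≤ M / 2 := by
      have h2 := mul_le_mul_of_nonneg_left hsM (mul_nonneg hm0.le hε0)
      have h3 := mul_le_mul_of_nonneg_right hε hM0
      nlinarith
    have hgΦ := mul_le_mul_of_nonneg_right (hm t ht) (hΦ.nonneg (z t))
    have hkz := mul_le_mul_of_nonneg_right hkm.le hz0
    nlinarith
  have hmem : ∀ t ∈ Ioo (0 : ℝ) (1 / 2), 1 / 2 + t ∈ Ioo (0 : ℝ) 1 ∧ 1 / 2 - t ∈ Ioo (0 : ℝ) 1 :=
    fun t ht => ⟨⟨by linarith [ht.1], by linarith [ht.2]⟩, ⟨by linarith [ht.2], by linarith [ht.1]⟩⟩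
  have hadd : MapsTo (fun t : ℝ => 1 / 2 + t) (Icc 0 (1 / 2)) (Icc 0 1) :=
    fun t ht => ⟨by linarith [ht.1], by linarith [ht.2]⟩
  have hsub : MapsTo (fun t : ℝ => 1 / 2 - t) (Icc 0 (1 / 2)) (Icc 0 1) :=
    fun t ht => ⟨by linarith [ht.2], by linarith [ht.1]⟩
  have hV : ∀ t ∈ Ioo (0 : ℝ) (1 / 2),
      w (1 / 2 + t) - w (1 / 2 - t) + M * (26 * t - 27 * t ^ 2) ≤ 0 := by
    intro t ht
    have := apply_le_of_hasDerivAt_nonpos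
      (f := fun r => w (1 / 2 + r) - w (1 / 2 - r) + M * (26 * r - 27 * r ^ 2))
      (f' := fun r => -(g (1 / 2 + r) * Φ (z (1 / 2 + r))) - -(-(g (1 / 2 - r) * Φ (z (1 / 2 - r))))
        + M * (26 * 1 - 27 * (2 * r))) ht.1.le
      ((((h.continuousOn_deriv.comp (by fun_prop) hadd).sub
        (h.continuousOn_deriv.comp (by fun_prop) hsub)).add (by fun_prop)).mono
          (Icc_subset_Icc le_rfl ht.2.le))
      (fun x hx => by
        have hx' := hmem x (Ioo_subset_Ioo le_rfl ht.2.le hx)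
        refine (((h.hasDerivAt_deriv hx'.1).comp_const_add (1 / 2) x).sub
          ((h.hasDerivAt_deriv hx'.2).comp_const_sub (1 / 2) x)).add
          ((((hasDerivAt_id x).const_mul 26).sub ?_).const_mul M)
        simpa using (hasDerivAt_pow 2 x).const_mul (27 : ℝ))
      (fun x hx => by
        have hx' := hmem x (Ioo_subset_Ioo le_rfl ht.2.le hx)
        have f1 := hforce _ (Ioo_subset_Icc_self hx'.1)
        have f2 := hforce _ (Ioo_subset_Icc_self hx'.2)
        rw [min_eq_right (by linarith [hx.1])] at f1
        rw [min_eq_left (by linarith [hx.1])] at f2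
        linarith)
    simp only [add_zero, sub_zero, sub_self] at this
    linarith
  have := apply_le_of_hasDerivAt_nonpos
    (f := fun r => z (1 / 2 + r) + z (1 / 2 - r) + M * (13 * r ^ 2 - 9 * r ^ 3))
    (f' := fun r => w (1 / 2 + r) + -w (1 / 2 - r) + M * (13 * (2 * r) - 9 * (3 * r ^ 2)))
    (a := 0) (b := 1 / 2) (by norm_num)
    (((h.continuousOn.comp (by fun_prop) hadd).add
        (h.continuousOn.comp (by fun_prop) hsub)).add (by fun_prop))
    (fun x hx => by
      have hx' := hmem x hx
      refine (((h.hasDerivAt hx'.1).comp_const_add (1 / 2) x).add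
        ((h.hasDerivAt hx'.2).comp_const_sub (1 / 2) x)).add ((HasDerivAt.sub ?_ ?_).const_mul M)
      · simpa using (hasDerivAt_pow 2 x).const_mul (13 : ℝ)
      · simpa using (hasDerivAt_pow 3 x).const_mul (9 : ℝ))
    (fun x hx => by linarith [hV x hx])
  norm_num [h.left] at this
  have hhalf := hM (1 / 2) (by norm_num)
  linarith

lemma solODE2 (h : IsShot_s2 g Φ s z w) (hΦ : IsCutoff Φ) (hgc : ContinuousOn g (Icc 0 1))
    {F : ℝ → ℝ} (hF : ∀ t ∈ Icc (0 : ℝ) 1, Φ (z t) = F (z t)) :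
    SolODE2 g F (Icc 0 1) z w (fun t => -(g t * Φ (z t))) :=
  ⟨h.hasDeriv, h.hasDeriv_deriv,
    (hgc.mul (hΦ.lipschitz.continuous.comp_continuousOn h.continuousOn)).neg,
    fun t ht => by simp only [hF t ht]; ring⟩

end IsShot_s2

/-- Shots exist for all slopes in a bounded interval and their endpoint data depend continuously
on the slope. -/
lemma exists_isShot_family_s2 {g Φ : ℝ → ℝ} (hΦ : IsCutoff Φ) (hgc : ContinuousOn g (Icc 0 1))
    (hg : ∀ t ∈ Icc (0 : ℝ) 1, 0 < g t) {S : ℝ} (hS : 0 ≤ S) :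
    ∃ z w : ℝ → ℝ → ℝ, (∀ s ∈ Icc 0 S, IsShot_s2 g Φ s (z s) (w s)) ∧
      ContinuousOn (fun s => z s 1) (Icc 0 S) ∧ ContinuousOn (fun s => w s 1) (Icc 0 S) := by
  obtain ⟨G, hG⟩ := isCompact_Icc.bddAbove_image hgc
  have hG : ∀ t ∈ Icc (0 : ℝ) 1, g t ≤ G := fun t ht => hG (mem_image_of_mem g ht)
  have hGpos : 0 < G := (hg 0 (by simp)).trans_le (hG 0 (by simp))
  set B : ℝ := S + G * S with hB
  have hB0 : 0 ≤ B := by positivity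
  set v : ℝ → ℝ × ℝ → ℝ × ℝ :=
    fun t x => (max (-B) (min x.2 B), -(g t * Φ (min x.1 S))) with hv
  have hmin : ∀ u, Φ (min u S) ≤ S := fun u => hΦ.le_of_le hS (min_le_right _ _)
  have hPL : IsPicardLindelof v (⟨0, by simp⟩ : Icc (0 : ℝ) 1) (0 : ℝ × ℝ)
      (B.toNNReal + S.toNNReal) S.toNNReal B.toNNReal (max 1 G.toNNReal) := by
    refine ⟨fun t ht => LipschitzWith.lipschitzOnWith ?_, fun x _ => ?_, fun t ht x _ => ?_, ?_⟩
    · refine LipschitzWith.prodMk ((LipschitzWith.prod_snd.min_const B).const_max (-B)) ?_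
      refine LipschitzWith.of_dist_le_mul fun x y => ?_
      have h1 := (hΦ.lipschitz.comp (LipschitzWith.prod_fst.min_const S)).dist_le_mul x y
      simp only [mul_one, NNReal.coe_one, one_mul, Function.comp_apply] at h1
      rw [dist_neg_neg, Real.dist_eq, ← mul_sub, abs_mul, abs_of_pos (hg t ht),
        Real.coe_toNNReal _ hGpos.le]
      exact mul_le_mul (hG t ht) h1 (abs_nonneg _) hGpos.le
    · exact continuousOn_const.prodMk (hgc.mul continuousOn_const).neg
    · rw [Real.coe_toNNReal _ hB0]
      refine max_le ?_ ?_
      · rw [Real.norm_eq_abs, abs_le]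
        exact ⟨le_max_left _ _, max_le (by linarith) (min_le_right _ _)⟩
      · rw [norm_neg, Real.norm_eq_abs, abs_of_nonneg (mul_nonneg (hg t ht).le (hΦ.nonneg _))]
        have := mul_le_mul (hG t ht) (hmin x.1) (hΦ.nonneg _) hGpos.le
        linarith
    · simp
  obtain ⟨α, hα, L, hL⟩ := hPL.exists_forall_mem_closedBall_eq_hasDerivWithinAt_lipschitzOnWith
  have hmem : ∀ s ∈ Icc 0 S, ((0 : ℝ), s) ∈ Metric.closedBall (0 : ℝ × ℝ) S.toNNReal := by
    intro s hs
    rw [mem_closedBall_zero_iff, Real.coe_toNNReal _ hS]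
    exact max_le (by simpa using hS) (by rw [Real.norm_eq_abs, abs_of_nonneg hs.1]; exact hs.2)
  refine ⟨fun s t => (α (0, s) t).1, fun s t => (α (0, s) t).2, fun s hs => ?_, ?_, ?_⟩
  · obtain ⟨h0, hd⟩ := hα _ (hmem s hs)
    have hd1 : ∀ t ∈ Icc (0 : ℝ) 1, HasDerivWithinAt (fun t => (α (0, s) t).1)
        (max (-B) (min (α (0, s) t).2 B)) (Icc 0 1) t := fun t ht => (hd t ht).fst
    have hd2 : ∀ t ∈ Icc (0 : ℝ) 1, HasDerivWithinAt (fun t => (α (0, s) t).2)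
        (-(g t * Φ (min (α (0, s) t).1 S))) (Icc 0 1) t := fun t ht => (hd t ht).snd
    have hc1 : ContinuousOn (fun t => (α (0, s) t).1) (Icc 0 1) :=
      fun t ht => (hd1 t ht).continuousWithinAt
    have hc2 : ContinuousOn (fun t => (α (0, s) t).2) (Icc 0 1) :=
      fun t ht => (hd2 t ht).continuousWithinAt
    have hup : ∀ t ∈ Icc (0 : ℝ) 1, (α (0, s) t).2 ≤ s := by
      intro t ht
      have := apply_le_of_hasDerivAt_nonpos ht.1 (hc2.mono (Icc_subset_Icc le_rfl ht.2))
        (fun x hx => (hd2 x (Ioo_subset_Icc_self (Ioo_subset_Ioo le_rfl ht.2 hx))).hasDerivAt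
          (Icc_mem_nhds hx.1 (hx.2.trans_le ht.2)))
        (fun x hx => neg_nonpos.2 (mul_nonneg
          (hg x (Ioo_subset_Icc_self (Ioo_subset_Ioo le_rfl ht.2 hx))).le (hΦ.nonneg _)))
      simpa only [h0] using this
    have hlo : ∀ t ∈ Icc (0 : ℝ) 1, -B ≤ (α (0, s) t).2 := by
      intro t ht
      have := apply_le_of_hasDerivAt_nonpos
        (f := fun r => -(α (0, s) r).2 - G * S * r)
        (f' := fun r => - -(g r * Φ (min (α (0, s) r).1 S)) - G * S * 1) ht.1
        ((hc2.mono (Icc_subset_Icc le_rfl ht.2)).neg.sub (by fun_prop))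
        (fun x hx => ((hd2 x (Ioo_subset_Icc_self (Ioo_subset_Ioo le_rfl ht.2 hx))).hasDerivAt
          (Icc_mem_nhds hx.1 (hx.2.trans_le ht.2))).neg.sub
            ((hasDerivAt_id x).const_mul (G * S)))
        (fun x hx => by
          have := mul_le_mul (hG x (Ioo_subset_Icc_self (Ioo_subset_Ioo le_rfl ht.2 hx)))
            (hmin (α (0, s) x).1) (hΦ.nonneg _) hGpos.le
          linarith)
      simp only [h0] at this
      nlinarith [mul_nonneg hGpos.le hS, ht.2, hs.1]
    have hw : ∀ t ∈ Icc (0 : ℝ) 1, max (-B) (min (α (0, s) t).2 B) = (α (0, s) t).2 := by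
      intro t ht
      have : s ≤ B := hs.2.trans (by rw [hB]; nlinarith [mul_nonneg hGpos.le hS])
      rw [min_eq_left ((hup t ht).trans this), max_eq_right (hlo t ht)]
    have hz : ∀ t ∈ Icc (0 : ℝ) 1, (α (0, s) t).1 ≤ S := by
      intro t ht
      have := apply_le_of_hasDerivAt_nonpos
        (f := fun r => (α (0, s) r).1 - s * r)
        (f' := fun r => max (-B) (min (α (0, s) r).2 B) - s * 1) ht.1
        ((hc1.mono (Icc_subset_Icc le_rfl ht.2)).sub (by fun_prop))
        (fun x hx => ((hd1 x (Ioo_subset_Icc_self (Ioo_subset_Ioo le_rfl ht.2 hx))).hasDerivAt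
          (Icc_mem_nhds hx.1 (hx.2.trans_le ht.2))).sub ((hasDerivAt_id x).const_mul s))
        (fun x hx => by
          have hx' := Ioo_subset_Icc_self (Ioo_subset_Ioo le_rfl ht.2 hx)
          rw [hw x hx']
          linarith [hup x hx'])
      simp only [h0] at this
      nlinarith [hs.1, hs.2, ht.2]
    refine ⟨by simp [h0], by simp [h0], fun t ht => ?_, fun t ht => ?_⟩
    · simpa only [hw t ht] using hd1 t ht
    · simpa only [min_eq_left (hz t ht)] using hd2 t ht
  all_goals
    have hcont := (hL 1 (by simp)).continuousOn.comp
      (Continuous.prodMk_right (0 : ℝ)).continuousOn hmem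
  · exact continuous_fst.comp_continuousOn hcont
  · exact continuous_snd.comp_continuousOn hcont

lemma exists_forall_abs_sub_le_of_tendsto_nhdsGT {Φ : ℝ → ℝ} (hΦ0 : Φ 0 = 0) {k : ℝ}
    (hk : Tendsto (fun u => Φ u / u) (𝓝[>] (0 : ℝ)) (𝓝 k)) {ε : ℝ} (hε : 0 < ε) :
    ∃ s > 0, ∀ u ∈ Icc 0 s, |Φ u - k * u| ≤ ε * s := by
  have hev := hk.eventually (Metric.closedBall_mem_nhds k hε)
  obtain ⟨δ, hδ, hδ'⟩ := mem_nhdsGT_iff_exists_Ioc_subset.1 hev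
  refine ⟨δ, hδ, fun u hu => ?_⟩
  rcases hu.1.eq_or_lt with rfl | hu0
  · simpa [hΦ0] using (mul_pos hε hδ).le
  · have h1 : |Φ u / u - k| ≤ ε := hδ' ⟨hu0, hu.2⟩
    have h2 : Φ u - k * u = (Φ u / u - k) * u := by field_simp
    rw [h2, abs_mul, abs_of_pos hu0]
    exact mul_le_mul h1 hu.2 hu0.le hε.le

lemma exists_forall_abs_sub_le_of_tendsto_atTop {Φ : ℝ → ℝ} (hΦ : Continuous Φ) {k : ℝ}
    (hk : Tendsto (fun u => Φ u / u) atTop (𝓝 k)) {ε : ℝ} (hε : 0 < ε) :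
    ∃ s > 0, ∀ u ∈ Icc 0 s, |Φ u - k * u| ≤ ε * s := by
  obtain ⟨R, hR⟩ := eventually_atTop.1 (hk.eventually (Metric.closedBall_mem_nhds k hε))
  obtain ⟨C, hC⟩ := isCompact_Icc.bddAbove_image (K := Icc 0 (max R 1))
    (f := fun u => |Φ u - k * u|) (by fun_prop)
  refine ⟨max (max R 1) (C / ε), by positivity, fun u hu => ?_⟩
  rcases le_or_gt u (max R 1) with hu1 | hu1
  · have h1 : |Φ u - k * u| ≤ C := hC (mem_image_of_mem _ ⟨hu.1, hu1⟩)
    calc |Φ u - k * u| ≤ ε * (C / ε) := by rwa [mul_div_cancel₀ _ hε.ne']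
      _ ≤ _ := mul_le_mul_of_nonneg_left (le_max_right _ _) hε.le
  · have hu0 : 0 < u := (zero_lt_one.trans_le (le_max_right R 1)).trans hu1
    have h1 : |Φ u / u - k| ≤ ε := hR u ((le_max_left _ _).trans hu1.le)
    have h2 : Φ u - k * u = (Φ u / u - k) * u := by field_simp
    rw [h2, abs_mul, abs_of_pos hu0]
    exact mul_le_mul h1 hu.2 hu0.le hε.le

lemma exists_shots_of_approx_linear {g Φ : ℝ → ℝ} (hΦ : IsCutoff Φ)
    (hgc : ContinuousOn g (Icc 0 1)) (hg : ∀ t ∈ Icc (0 : ℝ) 1, 0 < g t) {l k : ℝ} (hl0 : 0 ≤ l)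
    (hk0 : 0 ≤ k)
    (hl : ∀ ε > 0, ∃ s > 0, ∀ u ∈ Icc 0 s, |Φ u - l * u| ≤ ε * s)
    (hk : ∀ ε > 0, ∃ s > 0, ∀ u ∈ Icc 0 s, |Φ u - k * u| ≤ ε * s)
    (hlI : l * (∫ t in (0 : ℝ)..1, |g t|) < 1) (hkm : 27 < k * sInf (g '' Icc 0 1)) :
    (∃ s > 0, ∃ z w, IsShot_s2 g Φ s z w ∧ z 1 = 0) ∧
      ∃ s > 0, ∃ z w, IsShot_s2 g Φ s z w ∧ w 1 = 0 := by
  have hI0 : 0 ≤ ∫ t in (0 : ℝ)..1, |g t| :=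
    intervalIntegral.integral_nonneg zero_le_one fun t _ => abs_nonneg _
  set I := ∫ t in (0 : ℝ)..1, |g t|
  set m := sInf (g '' Icc 0 1)
  have hm0 : 0 < m := by
    by_contra! hle
    nlinarith
  have hm : ∀ t ∈ Icc (0 : ℝ) 1, m ≤ g t := fun t ht =>
    csInf_le (isCompact_Icc.bddBelow_image hgc) (mem_image_of_mem g ht)
  obtain ⟨G, hG⟩ := isCompact_Icc.bddAbove_image hgc
  have hG : ∀ t ∈ Icc (0 : ℝ) 1, g t ≤ G := fun t ht => hG (mem_image_of_mem g ht)
  have hGpos : 0 < G := (hg 0 (by simp)).trans_le (hG 0 (by simp))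
  obtain ⟨s₁, hs₁, h₁⟩ := hl ((1 - l * I) / (2 * (I + 1)))
    (div_pos (by linarith) (by linarith))
  obtain ⟨s₂, hs₂, h₂⟩ := hk (1 / (2 * m * (1 + G))) (by positivity)
  have hpos : 0 < (1 - l * I) / (2 * (I + 1)) := div_pos (by linarith) (by linarith)
  have hposI : (1 - l * I) / (2 * (I + 1)) * I < 1 - l * I := by
    rw [div_mul_eq_mul_div, div_lt_iff₀ (by linarith)]
    nlinarith
  obtain ⟨z, w, hsol, hzc, hwc⟩ := exists_isShot_family_s2 hΦ hgc hg (S := max s₁ s₂) (by positivity)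
  have hm₁ : s₁ ∈ Icc 0 (max s₁ s₂) := ⟨hs₁.le, le_max_left _ _⟩
  have hm₂ : s₂ ∈ Icc 0 (max s₁ s₂) := ⟨hs₂.le, le_max_right _ _⟩
  have hw₁ : 0 < w s₁ 1 := (hsol s₁ hm₁).right_deriv_pos hΦ hgc hg hs₁
    (c := l + (1 - l * I) / (2 * (I + 1)))
    (fun u hu => by
      have := (abs_le.1 (h₁ u hu)).2
      nlinarith [mul_le_mul_of_nonneg_left hu.2 hl0])
    (by positivity) (by rw [add_mul]; linarith)
  have hz₁ : 0 < z s₁ 1 := (hsol s₁ hm₁).pos_of_deriv_nonneg hΦ hg hs₁ (by simp) hw₁.le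
  have hz₂ : z s₂ 1 < 0 := (hsol s₂ hm₂).right_neg hΦ hg hs₂ hG hm0 hm hkm
    (ε := 1 / (2 * m * (1 + G))) (by field_simp; norm_num) (by positivity)
    (fun u hu => by linarith [(abs_le.1 (h₂ u hu)).1])
  have hw₂ : w s₂ 1 < 0 := by
    by_contra! hw
    exact absurd ((hsol s₂ hm₂).pos_of_deriv_nonneg hΦ hg hs₂ (by simp) hw) (by linarith)
  have hsubset : uIcc s₂ s₁ ⊆ Icc 0 (max s₁ s₂) := uIcc_subset_Icc hm₂ hm₁
  have hpos' : ∀ s ∈ uIcc s₂ s₁, 0 < s := fun s hs => (lt_min hs₂ hs₁).trans_le hs.1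
  constructor
  · obtain ⟨s, hs, hs0⟩ := intermediate_value_uIcc (hzc.mono hsubset)
      (mem_uIcc_of_le hz₂.le hz₁.le)
    exact ⟨s, hpos' s hs, _, _, hsol s (hsubset hs), hs0⟩
  · obtain ⟨s, hs, hs0⟩ := intermediate_value_uIcc (hwc.mono hsubset)
      (mem_uIcc_of_le hw₂.le hw₁.le)
    exact ⟨s, hpos' s hs, _, _, hsol s (hsubset hs), hs0⟩

lemma isCutoff_comp_max {F F' : ℝ → ℝ} (hF_cont : Continuous F)
    (hF_sign : ∀ u : ℝ, u ≠ 0 → 0 < F u * u)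
    (hF_deriv : ∀ u ∈ Ici (0:ℝ), HasDerivWithinAt F (F' u) (Ici 0) u)
    (hF'_bd : ∀ u ∈ Ici (0:ℝ), 0 ≤ F' u ∧ F' u ≤ 1) : IsCutoff fun u => F (max u 0) := by
  have hpos : ∀ u > 0, 0 < F u := fun u hu => pos_of_mul_pos_left (hF_sign u hu.ne') hu.le
  have hneg : ∀ u < 0, F u < 0 := fun u hu => by
    by_contra! h
    exact absurd (hF_sign u hu.ne) (not_lt.2 (mul_nonpos_of_nonneg_of_nonpos h hu.le))
  have h0 : F 0 = 0 := by
    refine le_antisymm ?_ ?_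
    · exact le_of_tendsto (hF_cont.continuousWithinAt (s := Iio 0) (x := 0))
        (eventually_mem_nhdsWithin.mono fun u hu => (hneg u hu).le)
    · exact ge_of_tendsto (hF_cont.continuousWithinAt (s := Ioi 0) (x := 0))
        (eventually_mem_nhdsWithin.mono fun u hu => (hpos u hu).le)
  refine ⟨LipschitzWith.of_dist_le_mul fun x y => ?_, fun u => ?_, fun u hu => ?_⟩
  · have h1 := (convex_Ici (0 : ℝ)).norm_image_sub_le_of_norm_hasDerivWithin_le hF_deriv
      (C := 1) (fun u hu => by
        rw [Real.norm_eq_abs, abs_of_nonneg (hF'_bd u hu).1]; exact (hF'_bd u hu).2)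
      (le_max_right y 0) (le_max_right x 0)
    have h2 := (LipschitzWith.id.max_const (0 : ℝ)).dist_le_mul x y
    simp only [NNReal.coe_one, one_mul, id, Real.dist_eq, Real.norm_eq_abs] at h1 h2 ⊢
    exact h1.trans h2
  · rcases (le_max_right u 0).eq_or_lt with h | h
    · simp only [← h, h0, le_refl]
    · exact (hpos _ h).le
  · simp only [max_eq_right hu, h0]

/-- Lemma 2: if `g > 0` is continuous on `[0,1]`, `min{k₀,k∞}·|g|_L < 1` and
`max{k₀,k∞}·min_{[0,1]} g > 27`, then `z'' + g F(z) = 0` has a solution in `Δ₁`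
and a solution in `Δ₂`. -/
theorem exists_Delta1_Delta2_for_second_order_positive_weight
    (g : ℝ → ℝ) (hg_cont : ContinuousOn g (Icc 0 1)) (hg_pos : ∀ t ∈ Icc (0:ℝ) 1, 0 < g t)
    (F : ℝ → ℝ) (k₀ kinf : ℝ)
    (hF_cont : Continuous F) (hF_sign : ∀ u : ℝ, u ≠ 0 → 0 < F u * u)
    (F' : ℝ → ℝ) (hF_deriv : ∀ u ∈ Ici (0:ℝ), HasDerivWithinAt F (F' u) (Ici 0) u)
    (hF'_bd : ∀ u ∈ Ici (0:ℝ), 0 ≤ F' u ∧ F' u ≤ 1)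
    (hk₀ : Tendsto (fun u => F u / u) (𝓝[>] (0:ℝ)) (𝓝 k₀))
    (hkinf : Tendsto (fun u => F u / u) atTop (𝓝 kinf))
    (hk₀_nonneg : 0 ≤ k₀) (hk_ne : k₀ ≠ kinf)
    (hcond1 : min k₀ kinf * (∫ t in (0:ℝ)..1, |g t|) < 1)
    (hcond2 : max k₀ kinf * sInf (g '' Icc 0 1) > 27) :
    (∃ z₁ z₁' z₁'' : ℝ → ℝ, SolODE2 g F (Icc 0 1) z₁ z₁' z₁'' ∧
      z₁ 0 = 0 ∧ z₁ 1 = 0 ∧ ∀ t ∈ Ioo (0:ℝ) 1, 0 < z₁ t) ∧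
    (∃ z₂ z₂' z₂'' : ℝ → ℝ, SolODE2 g F (Icc 0 1) z₂ z₂' z₂'' ∧
      z₂ 0 = 0 ∧ z₂' 1 = 0 ∧ ∀ t ∈ Ioc (0:ℝ) 1, 0 < z₂ t) := by
  set Φ : ℝ → ℝ := fun u => F (max u 0) with hΦdef
  have hΦ : IsCutoff Φ := isCutoff_comp_max hF_cont hF_sign hF_deriv hF'_bd
  have hΦF : ∀ u, 0 ≤ u → Φ u = F u := fun u hu => by simp only [hΦdef, max_eq_left hu]
  have hk₀' : Tendsto (fun u => Φ u / u) (𝓝[>] (0 : ℝ)) (𝓝 k₀) :=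
    hk₀.congr' (eventually_mem_nhdsWithin.mono fun u hu => by simp only [hΦF u (le_of_lt hu)])
  have hkinf' : Tendsto (fun u => Φ u / u) atTop (𝓝 kinf) :=
    hkinf.congr' ((eventually_ge_atTop 0).mono fun u hu => by simp only [hΦF u hu])
  have hkinf_nonneg : 0 ≤ kinf :=
    ge_of_tendsto hkinf' ((eventually_ge_atTop 0).mono fun u hu => div_nonneg (hΦ.nonneg u) hu)
  have happ₀ := fun ε (hε : ε > (0 : ℝ)) =>
    exists_forall_abs_sub_le_of_tendsto_nhdsGT (hΦ.eq_zero 0 le_rfl) hk₀' hε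
  have happinf := fun ε (hε : ε > (0 : ℝ)) =>
    exists_forall_abs_sub_le_of_tendsto_atTop hΦ.lipschitz.continuous hkinf' hε
  have hshots : (∃ s > 0, ∃ z w, IsShot_s2 g Φ s z w ∧ z 1 = 0) ∧
      ∃ s > 0, ∃ z w, IsShot_s2 g Φ s z w ∧ w 1 = 0 := by
    rcases lt_or_gt_of_ne hk_ne with hlt | hlt
    · rw [min_eq_left hlt.le] at hcond1
      rw [max_eq_right hlt.le] at hcond2
      exact exists_shots_of_approx_linear hΦ hg_cont hg_pos hk₀_nonneg hkinf_nonneg happ₀ happinf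
        hcond1 hcond2
    · rw [min_eq_right hlt.le] at hcond1
      rw [max_eq_left hlt.le] at hcond2
      exact exists_shots_of_approx_linear hΦ hg_cont hg_pos hkinf_nonneg hk₀_nonneg happinf happ₀
        hcond1 hcond2
  obtain ⟨⟨s₁, hs₁, z₁, w₁, h₁, hz₁⟩, s₂, hs₂, z₂, w₂, h₂, hw₂⟩ := hshots
  have hpos₁ : ∀ t ∈ Ioo (0 : ℝ) 1, 0 < z₁ t := fun t ht =>
    h₁.pos_of_right_eq_zero hΦ hg_pos hs₁ hz₁ ht
  have hpos₂ : ∀ t ∈ Ioc (0 : ℝ) 1, 0 < z₂ t := fun t ht =>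
    h₂.pos_of_right_deriv_eq_zero hΦ hg_pos hs₂ hw₂ ht
  refine ⟨⟨z₁, w₁, _, h₁.solODE2 hΦ hg_cont fun t ht => hΦF _ ?_, h₁.left, hz₁, hpos₁⟩,
    ⟨z₂, w₂, _, h₂.solODE2 hΦ hg_cont fun t ht => hΦF _ ?_, h₂.left, hw₂, hpos₂⟩⟩
  · rcases ht.1.eq_or_lt with rfl | h0
    · exact h₁.left.ge
    · rcases ht.2.eq_or_lt with rfl | h1
      · exact hz₁.ge
      · exact (hpos₁ t ⟨h0, h1⟩).le
  · rcases ht.1.eq_or_lt with rfl | h0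
    · exact h₂.left.ge
    · exact (hpos₂ t ⟨h0, ht.2⟩).le
end
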